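/- arXiv:0910.3883 — 6 statements merged into one kernel-verified Lean document; each statement's English description precedes it below -/
import Mathlib

section
/- For every pair of distinct vertices i ≠ j, the expected off-diagonal weight satisfies E[w_{ij}] = E[a_{ij}/(d_i+1)] = (q^n + np - 1)/(np(n-1)) = (1 - f_1(p,n))/(n-1). -/
open MeasureTheory ProbabilityTheory Finset

/-- The factors whose product over `l` represents `y k * x ^ (∑ l, y l)` for `y` with values in
`{0, 1}`. -/
def indicatorFactor {ι : Type*} [DecidableEq ι] (k : ι) (x : ℝ) (l : ι) (y : ℝ) : ℝ :=
  if l = k then x * y else 1 + (x - 1) * y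

lemma measurable_indicatorFactor {ι : Type*} [DecidableEq ι] (k l : ι) :
    Measurable (fun z : ℝ × ℝ => indicatorFactor k z.1 l z.2) := by
  unfold indicatorFactor
  split_ifs <;> fun_prop

lemma abs_indicatorFactor_le_one {ι : Type*} [DecidableEq ι] (k l : ι) {x y : ℝ}
    (hx : x ∈ Set.Ioc (0 : ℝ) 1) (hy : y = 0 ∨ y = 1) : |indicatorFactor k x l y| ≤ 1 := by
  obtain ⟨h0, h1⟩ := hx
  unfold indicatorFactor
  rcases hy with rfl | rfl <;> split_ifs <;> simp [abs_le] <;> constructor <;> linarith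

lemma prod_indicatorFactor {ι : Type*} [Fintype ι] [DecidableEq ι] (k : ι) (x : ℝ) {y : ι → ℝ}
    (hy : ∀ l, y l = 0 ∨ y l = 1) :
    ∏ l, indicatorFactor k x l (y l) = y k * x ^ #{l | y l = 1} := by
  rcases hy k with hk | hk
  · rw [hk, zero_mul]
    exact prod_eq_zero (mem_univ k) (by simp [indicatorFactor, hk])
  · have h : ∀ l, indicatorFactor k x l (y l) = if y l = 1 then x else 1 := by
      intro l
      unfold indicatorFactor
      by_cases hl : l = k
      · subst hl
        simp [hk]
      · rcases hy l with h | h <;> simp [hl, h]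
    simp [h, hk, prod_ite]

lemma sum_eq_card_filter_eq_one {ι : Type*} [Fintype ι] {y : ι → ℝ}
    (hy : ∀ l, y l = 0 ∨ y l = 1) : ∑ l, y l = (#{l | y l = 1} : ℝ) := by
  rw [card_filter, Nat.cast_sum]
  refine sum_congr rfl fun l _ => ?_
  rcases hy l with h | h <;> simp [h]

lemma integral_prod_indicatorFactor {ι : Type*} [Fintype ι] [DecidableEq ι] (k : ι) {y : ι → ℝ}
    (hy : ∀ l, y l = 0 ∨ y l = 1) :
    ∫ x in Set.Ioc (0 : ℝ) 1, ∏ l, indicatorFactor k x l (y l) = y k / (∑ l, y l + 1) := by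
  simp_rw [prod_indicatorFactor k _ hy]
  rw [integral_const_mul, ← intervalIntegral.integral_of_le zero_le_one, integral_pow,
    sum_eq_card_filter_eq_one hy]
  simp [div_eq_mul_inv]

lemma integral_mul_affine_pow {p : ℝ} (hp : p ≠ 0) (m : ℕ) :
    ∫ x in Set.Ioc (0 : ℝ) 1, x * p * (1 + (x - 1) * p) ^ m =
      ((1 - p) ^ (m + 2) + (m + 2) * p - 1) / ((m + 2) * p * (m + 1)) := by
  have hm1 : (m : ℝ) + 1 ≠ 0 := by positivity
  have hm2 : (m : ℝ) + 2 ≠ 0 := by positivity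
  rw [← intervalIntegral.integral_of_le zero_le_one,
    intervalIntegral.integral_eq_sub_of_hasDerivAt (f := fun x =>
      x * (1 + (x - 1) * p) ^ (m + 1) / (m + 1)
        - (1 + (x - 1) * p) ^ (m + 2) / ((m + 2) * p * (m + 1)))]
  · have h : 1 + (0 - 1) * p = 1 - p := by ring
    simp only [h, sub_self, zero_mul, add_zero, one_pow]
    field_simp
    ring
  · intro x _
    have hlin : HasDerivAt (fun x : ℝ => 1 + (x - 1) * p) p x := by
      simpa using (((hasDerivAt_id x).sub_const 1).mul_const p).const_add 1
    refine ((((hasDerivAt_id' x).fun_mul (hlin.fun_pow (m + 1))).div_const ((m : ℝ) + 1)).fun_sub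
      ((hlin.fun_pow (m + 2)).div_const (((m : ℝ) + 2) * p * (m + 1)))).congr_deriv ?_
    simp only [Nat.add_sub_cancel, Nat.add_succ_sub_one]
    push_cast
    field_simp
    ring
  · exact Continuous.intervalIntegrable (by fun_prop) _ _

/-- For independent `{0, 1}`-valued variables `X l` of mean `p`, the expectation of
`X k / (∑ l, X l + 1)`. -/
lemma integral_div_sum_add_one {ι Ω : Type*} [Fintype ι] [MeasurableSpace Ω]
    {μ : Measure Ω} [IsProbabilityMeasure μ] {p : ℝ} (hp : p ≠ 0) {X : ι → Ω → ℝ}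
    (hX01 : ∀ l ω, X l ω = 0 ∨ X l ω = 1) (hmeas : ∀ l, Measurable (X l))
    (hmean : ∀ l, ∫ ω, X l ω ∂μ = p) (hind : iIndepFun X μ) (k : ι) {m : ℕ}
    (hcard : Fintype.card ι = m + 1) :
    ∫ ω, X k ω / (∑ l, X l ω + 1) ∂μ =
      ((1 - p) ^ (m + 2) + (m + 2) * p - 1) / ((m + 2) * p * (m + 1)) := by
  classical
  have hint : ∀ l, Integrable (X l) μ := fun l =>
    Integrable.of_bound (hmeas l).aestronglyMeasurable 1
      (ae_of_all _ fun ω => by rcases hX01 l ω with h | h <;> simp [h])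
  have hfactor : ∀ x l, ∫ ω, indicatorFactor k x l (X l ω) ∂μ =
      if l = k then x * p else 1 + (x - 1) * p := by
    intro x l
    unfold indicatorFactor
    split_ifs
    · rw [integral_const_mul, hmean]
    · rw [integral_add (integrable_const _) ((hint l).const_mul _), integral_const_mul, hmean]
      simp
  have hprod : ∀ x : ℝ, ∫ ω, ∏ l, indicatorFactor k x l (X l ω) ∂μ =
      x * p * (1 + (x - 1) * p) ^ m := by
    intro x
    rw [hind.integral_fun_prod_comp (f := fun l y => indicatorFactor k x l y)
      (fun l => (hmeas l).aemeasurable)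
      (fun l => ((measurable_indicatorFactor k l).comp
        measurable_prodMk_left).aestronglyMeasurable)]
    simp_rw [hfactor]
    rw [← mul_prod_erase univ _ (mem_univ k), if_pos rfl,
      prod_congr rfl fun l hl => if_neg (ne_of_mem_erase hl), prod_const,
      card_erase_of_mem (mem_univ k), card_univ, hcard, Nat.add_sub_cancel]
  have hswap : Integrable (Function.uncurry fun (ω : Ω) (x : ℝ) =>
      ∏ l, indicatorFactor k x l (X l ω)) (μ.prod (volume.restrict (Set.Ioc (0 : ℝ) 1))) := by
    have hae : ∀ᵐ z : Ω × ℝ ∂μ.prod (volume.restrict (Set.Ioc (0 : ℝ) 1)),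
        z.2 ∈ Set.Ioc (0 : ℝ) 1 :=
      Measure.quasiMeasurePreserving_snd.ae (ae_restrict_mem measurableSet_Ioc)
    refine Integrable.of_bound (Measurable.aestronglyMeasurable ?_) 1 ?_
    · exact Finset.measurable_fun_prod _ fun l _ => (measurable_indicatorFactor k l).comp
        (measurable_snd.prodMk ((hmeas l).comp measurable_fst))
    · filter_upwards [hae] with z hz
      simp only [Function.uncurry, Real.norm_eq_abs, abs_prod]
      exact prod_le_one (fun _ _ => abs_nonneg _)
        fun l _ => abs_indicatorFactor_le_one k l hz (hX01 l _)
  calc ∫ ω, X k ω / (∑ l, X l ω + 1) ∂μ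
      = ∫ ω, (∫ x in Set.Ioc (0 : ℝ) 1, ∏ l, indicatorFactor k x l (X l ω)) ∂μ := by
        refine integral_congr_ae (ae_of_all _ fun ω => ?_)
        exact (integral_prod_indicatorFactor k fun l => hX01 l ω).symm
    _ = ∫ x in Set.Ioc (0 : ℝ) 1, (∫ ω, ∏ l, indicatorFactor k x l (X l ω) ∂μ) :=
        integral_integral_swap hswap
    _ = _ := by
        simp_rw [hprod]
        exact integral_mul_affine_pow hp m

lemma integral_eq_measureReal_eq_one {Ω : Type*} [MeasurableSpace Ω] {μ : Measure Ω}
    {X : Ω → ℝ} (hX01 : ∀ ω, X ω = 0 ∨ X ω = 1) (hmeas : Measurable X) :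
    ∫ ω, X ω ∂μ = μ.real {ω | X ω = 1} := by
  have hset : MeasurableSet {ω | X ω = 1} := hmeas (measurableSet_singleton 1)
  rw [← integral_indicator_one hset]
  refine integral_congr_ae (ae_of_all _ fun ω => ?_)
  rcases hX01 ω with h | h <;> simp [Set.indicator, h]

/-- For distinct vertices `i ≠ j`, the expected off-diagonal weight
satisfies `E[w_{ij}] = E[a_{ij}/(d_i+1)] = (q^n+np-1)/(np(n-1)) = (1-f₁(p,n))/(n-1)`. -/
theorem expected_offdiagonal_weight
    {Ω : Type*} [MeasurableSpace Ω] (μ : Measure Ω) [IsProbabilityMeasure μ]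
    (n : ℕ) (hn : 2 ≤ n) (p q : ℝ) (hp : p ∈ Set.Ioc (0 : ℝ) 1) (hq : q = 1 - p)
    (a : Fin n → Fin n → Ω → ℝ)
    (ha01 : ∀ i j ω, a i j ω = 0 ∨ a i j ω = 1)
    (hdiag : ∀ i ω, a i i ω = 0)
    (hmeas : ∀ i j, Measurable (a i j))
    (hber : ∀ i j, i ≠ j → μ {ω | a i j ω = 1} = ENNReal.ofReal p)
    (hind : iIndepFun (m := fun _ => Real.measurableSpace)
      (fun ij : {ij : Fin n × Fin n // ij.1 ≠ ij.2} => a ij.1.1 ij.1.2) μ)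
    (d : Fin n → Ω → ℝ) (hd : ∀ i ω, d i ω = ∑ j, a i j ω)
    (f₁ : ℝ) (hf₁ : f₁ = (1 - q ^ n) / (n * p))
    (i j : Fin n) (hij : i ≠ j) :
    (∫ ω, a i j ω / (d i ω + 1) ∂μ) = (q ^ n + n * p - 1) / (n * p * (n - 1)) ∧
    (∫ ω, a i j ω / (d i ω + 1) ∂μ) = (1 - f₁) / (n - 1) := by
  obtain ⟨m, rfl⟩ := Nat.exists_eq_add_of_le' hn
  have hp0 : p ≠ 0 := hp.1.ne'
  have key : (∫ ω, a i j ω / (d i ω + 1) ∂μ) =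
      ((1 - p) ^ (m + 2) + (m + 2) * p - 1) / ((m + 2) * p * (m + 1)) := by
    have hinj : Function.Injective (fun l : {l : Fin (m + 2) // l ≠ i} =>
        (⟨(i, l.1), l.2.symm⟩ : {ij : Fin (m + 2) × Fin (m + 2) // ij.1 ≠ ij.2})) := by
      intro l l' h
      simpa [Subtype.ext_iff] using h
    have hrow : iIndepFun (fun l : {l : Fin (m + 2) // l ≠ i} => a i l.1) μ :=
      hind.precomp hinj
    have hmean : ∀ l : {l : Fin (m + 2) // l ≠ i}, ∫ ω, a i l.1 ω ∂μ = p := by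
      intro l
      rw [integral_eq_measureReal_eq_one (ha01 i l.1) (hmeas i l.1), measureReal_def,
        hber i l.1 l.2.symm, ENNReal.toReal_ofReal hp.1.le]
    have hsum : ∀ ω, d i ω = ∑ l : {l : Fin (m + 2) // l ≠ i}, a i l.1 ω := by
      intro ω
      rw [hd, Fintype.sum_eq_add_sum_subtype_ne _ i, hdiag, zero_add]
    simp_rw [hsum]
    exact integral_div_sum_add_one (X := fun l : {l : Fin (m + 2) // l ≠ i} => a i l.1) hp0
      (fun l => ha01 i l.1) (fun l => hmeas i l.1) hmean hrow ⟨j, hij.symm⟩ (by simp)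
  have hm1 : (m : ℝ) + 1 ≠ 0 := by positivity
  have hm2 : (m : ℝ) + 2 ≠ 0 := by positivity
  have hcast : ((m + 2 : ℕ) : ℝ) - 1 = m + 1 := by
    push_cast
    ring
  rw [key, hf₁, hq, hcast]
  push_cast
  refine ⟨rfl, ?_⟩
  field_simp
  ring
end

section
/- For every pair of distinct vertices i ≠ j, E[a_{ij}/(d_i+1)^2] = (f_1(p,n) - q^{n-1} H(p,n))/(n-1). -/
open MeasureTheory ProbabilityTheory Finset

/-- The expectation of `g` under the binomial distribution with parameters `m` and `p`. -/
noncomputable def binomialExpectation (p : ℝ) (m : ℕ) (g : ℝ → ℝ) : ℝ :=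
  ∑ k ∈ range (m + 1), (m.choose k : ℝ) * p ^ k * (1 - p) ^ (m - k) * g k

theorem binomialExpectation_succ (p : ℝ) (m : ℕ) (g : ℝ → ℝ) :
    binomialExpectation p (m + 1) g =
      p * binomialExpectation p m (fun x => g (1 + x)) + (1 - p) * binomialExpectation p m g := by
  unfold binomialExpectation
  rw [sum_range_succ', mul_sum, mul_sum]
  have h1 : ∀ k ∈ range (m + 1),
      ((m + 1).choose (k + 1) : ℝ) * p ^ (k + 1) * (1 - p) ^ (m + 1 - (k + 1)) * g (k + 1 : ℕ) =
        p * ((m.choose k : ℝ) * p ^ k * (1 - p) ^ (m - k) * g (1 + k)) +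
        (m.choose (k + 1) : ℝ) * p ^ (k + 1) * (1 - p) ^ (m - k) * g (k + 1 : ℕ) := by
    intro k _
    rw [Nat.choose_succ_succ, Nat.add_sub_add_right]
    push_cast
    rw [add_comm (1 : ℝ) k]
    ring
  rw [sum_congr rfl h1, sum_add_distrib, add_assoc]
  congr 1
  rw [sum_range_succ, sum_range_succ' _ m]
  simp only [Nat.choose_succ_self, Nat.cast_zero, zero_mul, add_zero, Nat.choose_zero_right,
    Nat.cast_one, pow_zero, Nat.sub_zero]
  congr 1
  · refine sum_congr rfl fun k hk => ?_
    have hm : m - k = m - (k + 1) + 1 := by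
      have := mem_range.1 hk
      omega
    rw [hm, pow_succ (1 - p)]
    ring
  · ring

theorem integrable_of_mem_zero_one {Ω : Type*} [MeasurableSpace Ω] {μ : Measure Ω}
    [IsProbabilityMeasure μ] {X : Ω → ℝ} (hX : Measurable X) (h01 : ∀ ω, X ω = 0 ∨ X ω = 1) :
    Integrable X μ :=
  Integrable.of_bound hX.aestronglyMeasurable 1
    (.of_forall fun ω => by rcases h01 ω with h | h <;> simp [h])

theorem integral_of_mem_zero_one {Ω : Type*} [MeasurableSpace Ω] {μ : Measure Ω}
    {X : Ω → ℝ} {p : ℝ} (hp : 0 ≤ p) (hX : Measurable X) (h01 : ∀ ω, X ω = 0 ∨ X ω = 1)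
    (hber : μ {ω | X ω = 1} = ENNReal.ofReal p) : ∫ ω, X ω ∂μ = p := by
  have hXe : X = Set.indicator {ω | X ω = 1} 1 := by
    funext ω
    rcases h01 ω with h | h <;> simp [Set.indicator, h]
  have hs : MeasurableSet {ω | X ω = 1} := hX (measurableSet_singleton 1)
  rw [hXe, integral_indicator_one hs, measureReal_def, hber, ENNReal.toReal_ofReal hp]

/-- A measurable function of a sum of independent Bernoulli variables is integrable, and its
expectation is given by the binomial distribution. -/
theorem integrable_and_integral_comp_sum_bernoulli {Ω ι : Type*} [MeasurableSpace Ω]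
    {μ : Measure Ω} [IsProbabilityMeasure μ] {X : ι → Ω → ℝ} {p : ℝ} (hp : 0 ≤ p)
    (hX : ∀ k, Measurable (X k)) (h01 : ∀ k ω, X k ω = 0 ∨ X k ω = 1)
    (hber : ∀ k, μ {ω | X k ω = 1} = ENNReal.ofReal p) (hind : iIndepFun X μ)
    (s : Finset ι) {g : ℝ → ℝ} (hg : Measurable g) :
    Integrable (fun ω => g (∑ k ∈ s, X k ω)) μ ∧
      ∫ ω, g (∑ k ∈ s, X k ω) ∂μ = binomialExpectation p #s g := by
  classical
  induction s using Finset.induction_on generalizing g with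
  | empty => simp [binomialExpectation]
  | insert m s hm ih =>
    have hg1 : Measurable fun x => g (1 + x) := hg.comp (measurable_const_add 1)
    obtain ⟨hi1, he1⟩ := ih hg1
    obtain ⟨hi0, he0⟩ := ih hg
    have hI : IndepFun (X m) (fun ω => ∑ k ∈ s, X k ω) μ := by
      have h := (hind.indepFun_finsetSum_of_notMem hX hm).symm
      simpa only [Finset.sum_fn] using h
    have hI1 : IndepFun (X m) (fun ω => g (1 + ∑ k ∈ s, X k ω)) μ :=
      hI.comp measurable_id hg1
    have hI0 : IndepFun (fun ω => 1 - X m ω) (fun ω => g (∑ k ∈ s, X k ω)) μ :=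
      hI.comp (measurable_const.sub measurable_id) hg
    have hXi := integrable_of_mem_zero_one (μ := μ) (hX m) (h01 m)
    have hYi : Integrable (fun ω => 1 - X m ω) μ := (integrable_const 1).sub hXi
    have hXe := integral_of_mem_zero_one hp (hX m) (h01 m) (hber m)
    have hYe : ∫ ω, (1 - X m ω) ∂μ = 1 - p := by
      rw [integral_sub (integrable_const 1) hXi, hXe]
      simp
    have hp1 : Integrable (fun ω => X m ω * g (1 + ∑ k ∈ s, X k ω)) μ :=
      hI1.integrable_mul hXi hi1
    have hp0 : Integrable (fun ω => (1 - X m ω) * g (∑ k ∈ s, X k ω)) μ :=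
      hI0.integrable_mul hYi hi0
    have hsplit : (fun ω => g (∑ k ∈ insert m s, X k ω)) = fun ω =>
        X m ω * g (1 + ∑ k ∈ s, X k ω) + (1 - X m ω) * g (∑ k ∈ s, X k ω) := by
      funext ω
      rw [sum_insert hm]
      rcases h01 m ω with h | h <;> simp [h]
    rw [hsplit]
    refine ⟨hp1.add hp0, ?_⟩
    rw [integral_add hp1 hp0, hI1.integral_fun_mul_eq_mul_integral
      hXi.aestronglyMeasurable hi1.aestronglyMeasurable,
      hI0.integral_fun_mul_eq_mul_integral hYi.aestronglyMeasurable hi0.aestronglyMeasurable,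
      hXe, hYe, he1, he0, card_insert_of_notMem hm, binomialExpectation_succ]

theorem binomialExpectation_inv_add_one {p : ℝ} (hp : p ≠ 0) (m : ℕ) :
    binomialExpectation p m (fun x => 1 / (x + 1)) =
      (1 - (1 - p) ^ (m + 1)) / ((m + 1 : ℕ) * p) := by
  have hm : ((m + 1 : ℕ) : ℝ) ≠ 0 := by positivity
  rw [eq_div_iff (mul_ne_zero hm hp)]
  have hb := add_pow p (1 - p) (m + 1)
  rw [add_sub_cancel, one_pow, sum_range_succ'] at hb
  have hs : binomialExpectation p m (fun x => 1 / (x + 1)) * ((m + 1 : ℕ) * p) =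
      ∑ k ∈ range (m + 1),
        p ^ (k + 1) * (1 - p) ^ (m + 1 - (k + 1)) * ((m + 1).choose (k + 1) : ℝ) := by
    rw [binomialExpectation, sum_mul]
    refine sum_congr rfl fun k _ => ?_
    have hk : (k : ℝ) + 1 ≠ 0 := by positivity
    have hc : ((m + 1 : ℕ) : ℝ) * m.choose k = (m + 1).choose (k + 1) * ((k : ℝ) + 1) := by
      exact_mod_cast Nat.add_one_mul_choose_eq m k
    rw [Nat.add_sub_add_right]
    field_simp
    linear_combination (p ^ k * p * (1 - p) ^ (m - k)) * hc
  rw [hs]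
  simp only [pow_zero, Nat.sub_zero, Nat.choose_zero_right, Nat.cast_one, one_mul, mul_one] at hb
  linarith

theorem mul_binomialExpectation_inv_add_two_sq (p : ℝ) (m : ℕ) :
    ((m : ℝ) + 1) * (p * binomialExpectation p m (fun x => 1 / (x + 2) ^ 2)) =
      binomialExpectation p (m + 1) (fun x => 1 / (x + 1)) -
        binomialExpectation p (m + 1) (fun x => 1 / (x + 1) ^ 2) := by
  unfold binomialExpectation
  rw [← sum_sub_distrib, mul_sum, mul_sum, sum_range_succ' _ (m + 1)]
  simp only [Nat.cast_zero, zero_add, one_pow, sub_self, add_zero]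
  refine sum_congr rfl fun k _ => ?_
  have hk : (k : ℝ) + 2 ≠ 0 := by positivity
  have hk' : (k : ℝ) + 1 + 1 ≠ 0 := by positivity
  have hc : ((m : ℝ) + 1) * m.choose k = (m + 1).choose (k + 1) * ((k : ℝ) + 1) := by
    exact_mod_cast Nat.add_one_mul_choose_eq m k
  rw [Nat.add_sub_add_right]
  push_cast
  rw [show (k : ℝ) + 1 + 1 = k + 2 by ring]
  field_simp
  linear_combination (p ^ k * p * (1 - p) ^ (m - k)) * hc

theorem binomialExpectation_eq_pow_mul_sum {p : ℝ} (hp : 1 - p ≠ 0) (m : ℕ) (g : ℝ → ℝ) :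
    binomialExpectation p m g =
      (1 - p) ^ m * ∑ k ∈ range (m + 1), g k * (m.choose k : ℝ) * (p / (1 - p)) ^ k := by
  rw [binomialExpectation, mul_sum]
  refine sum_congr rfl fun k hk => ?_
  have hkm : k ≤ m := Nat.lt_succ_iff.1 (mem_range.1 hk)
  rw [pow_sub₀ _ hp hkm, div_pow]
  ring

/-- For distinct vertices `i ≠ j`,
`E[a_{ij}/(d_i+1)²] = (f₁(p,n) - q^{n-1} H(p,n))/(n-1)`. -/
theorem expected_aij_over_degree_squared
    {Ω : Type*} [MeasurableSpace Ω] (μ : Measure Ω) [IsProbabilityMeasure μ]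
    (n : ℕ) (hn : 2 ≤ n) (p q : ℝ) (hp : p ∈ Set.Ioo (0 : ℝ) 1) (hq : q = 1 - p)
    (a : Fin n → Fin n → Ω → ℝ)
    (ha01 : ∀ i j ω, a i j ω = 0 ∨ a i j ω = 1)
    (hdiag : ∀ i ω, a i i ω = 0)
    (hmeas : ∀ i j, Measurable (a i j))
    (hber : ∀ i j, i ≠ j → μ {ω | a i j ω = 1} = ENNReal.ofReal p)
    (hind : iIndepFun (m := fun _ => Real.measurableSpace)
      (fun ij : {ij : Fin n × Fin n // ij.1 ≠ ij.2} => a ij.1.1 ij.1.2) μ)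
    (d : Fin n → Ω → ℝ) (hd : ∀ i ω, d i ω = ∑ j, a i j ω)
    (f₁ : ℝ) (hf₁ : f₁ = (1 - q ^ n) / (n * p))
    (H : ℝ)
    (hH : H = ∑ k ∈ Finset.range n,
      (1 / ((k : ℝ) + 1) ^ 2) * ((n - 1).choose k : ℝ) * (p / q) ^ k)
    (i j : Fin n) (hij : i ≠ j) :
    (∫ ω, a i j ω / (d i ω + 1) ^ 2 ∂μ) = (f₁ - q ^ (n - 1) * H) / (n - 1) := by
  classical
  subst hq hf₁ hH
  obtain ⟨m, rfl⟩ : ∃ m, n = m + 2 := ⟨n - 2, by omega⟩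
  have hp0 : p ≠ 0 := hp.1.ne'
  have hq0 : 1 - p ≠ 0 := (sub_pos.2 hp.2).ne'
  let X : {k : Fin (m + 2) // k ≠ i} → Ω → ℝ := fun k => a i k
  have hX : ∀ k, Measurable (X k) := fun k => hmeas i k
  have h01 : ∀ k ω, X k ω = 0 ∨ X k ω = 1 := fun k ω => ha01 i k ω
  have hXber : ∀ k, μ {ω | X k ω = 1} = ENNReal.ofReal p := fun k => hber i k k.2.symm
  have hXind : iIndepFun X μ :=
    hind.precomp (g := fun k : {k : Fin (m + 2) // k ≠ i} => ⟨(i, k.1), k.2.symm⟩)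
      fun k l hkl => Subtype.ext (congrArg (fun x => x.1.2) hkl)
  let e : {k : Fin (m + 2) // k ≠ i} := ⟨j, hij.symm⟩
  let s := univ.erase e
  have hes : e ∉ s := notMem_erase e univ
  have hcard : #s = m := by simp [s]
  have hdeg : ∀ ω, d i ω = X e ω + ∑ k ∈ s, X k ω := by
    intro ω
    rw [hd, add_sum_erase univ (fun k => X k ω) (mem_univ e),
      Fintype.sum_eq_add_sum_subtype_ne _ i, hdiag, zero_add]
  have hg : Measurable fun x : ℝ => 1 / (x + 2) ^ 2 := by fun_prop
  obtain ⟨hgi, hge⟩ :=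
    integrable_and_integral_comp_sum_bernoulli hp.1.le hX h01 hXber hXind s hg
  have hI : IndepFun (X e) (fun ω => 1 / ((∑ k ∈ s, X k ω) + 2) ^ 2) μ := by
    have h := (hXind.indepFun_finsetSum_of_notMem hX hes).symm
    simp only [Finset.sum_fn] at h
    exact h.comp measurable_id hg
  have hfun : (fun ω => a i j ω / (d i ω + 1) ^ 2) =
      fun ω => X e ω * (1 / ((∑ k ∈ s, X k ω) + 2) ^ 2) := by
    funext ω
    rw [hdeg, show a i j ω = X e ω from rfl]
    rcases h01 e ω with h | h
    · simp [h]
    · rw [h, one_mul]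
      ring
  rw [hfun, hI.integral_fun_mul_eq_mul_integral (hX e).aestronglyMeasurable
      hgi.aestronglyMeasurable,
    integral_of_mem_zero_one hp.1.le (hX e) (h01 e) (hXber e), hge, hcard,
    ← binomialExpectation_inv_add_one hp0 (m + 1), show m + 2 - 1 = m + 1 from rfl,
    ← binomialExpectation_eq_pow_mul_sum hq0 (m + 1) (fun x => 1 / (x + 1) ^ 2),
    ← mul_binomialExpectation_inv_add_two_sq]
  have hm : (m : ℝ) + 1 ≠ 0 := by positivity
  have hm' : ((m + 2 : ℕ) : ℝ) - 1 = m + 1 := by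
    push_cast
    ring
  rw [hm', mul_div_cancel_left₀ _ hm]
end

section
/- For any three distinct vertices i, j, s, E[a_{ij} a_{is}/(d_i+1)^2] = (1 + 2 q^{n-1} H(p,n) - 3 f_1(p,n)) / ((n-1)(n-2)). -/
open MeasureTheory ProbabilityTheory Finset

lemma sum_zero_one_eq_sum_powerset {ι : Type*} [DecidableEq ι] (R : Finset ι) (x : ι → ℝ)
    (hx : ∀ k ∈ R, x k = 0 ∨ x k = 1) (g : ℝ → ℝ) :
    g (∑ k ∈ R, x k) =
      ∑ T ∈ R.powerset, g (#T : ℝ) * ((∏ k ∈ T, x k) * ∏ k ∈ R \ T, (1 - x k)) := by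
  induction R using Finset.induction_on generalizing g with
  | empty => simp
  | insert b R hb ih =>
    have hxR : ∀ k ∈ R, x k = 0 ∨ x k = 1 := fun k hk => hx k (mem_insert_of_mem hk)
    have hout : ∀ T ∈ R.powerset, g (#T : ℝ) *
        ((∏ k ∈ T, x k) * ∏ k ∈ insert b R \ T, (1 - x k)) =
        (1 - x b) * (g (#T : ℝ) * ((∏ k ∈ T, x k) * ∏ k ∈ R \ T, (1 - x k))) := by
      intro T hT
      have hbT : b ∉ T := fun h => hb (mem_powerset.1 hT h)
      rw [insert_sdiff_of_notMem _ hbT, prod_insert (by simp [hb])]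
      ring
    have hin : ∀ T ∈ R.powerset, g (#(insert b T) : ℝ) *
        ((∏ k ∈ insert b T, x k) * ∏ k ∈ insert b R \ insert b T, (1 - x k)) =
        x b * (g ((#T : ℝ) + 1) * ((∏ k ∈ T, x k) * ∏ k ∈ R \ T, (1 - x k))) := by
      intro T hT
      have hbT : b ∉ T := fun h => hb (mem_powerset.1 hT h)
      rw [insert_sdiff_insert, sdiff_insert_of_notMem hb, prod_insert hbT,
        card_insert_of_notMem hbT]
      push_cast
      ring
    rw [sum_powerset_insert hb, sum_congr rfl hout, sum_congr rfl hin, ← mul_sum, ← mul_sum,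
      ← ih hxR, ← ih hxR (fun y => g (y + 1)), sum_insert hb]
    rcases hx b (mem_insert_self _ _) with h | h <;> simp [h, add_comm]

section Bernoulli

variable {Ω ι : Type*} [MeasurableSpace Ω] {μ : Measure Ω} [IsProbabilityMeasure μ]
  [Fintype ι] [DecidableEq ι] {X : ι → Ω → ℝ} {p : ℝ}

lemma integral_prod_mul_prod_one_sub (hind : iIndepFun X μ) (hX : ∀ k, Measurable (X k))
    (hint : ∀ k, Integrable (X k) μ) (hmean : ∀ k, ∫ ω, X k ω ∂μ = p)
    {U V : Finset ι} (hUV : Disjoint U V) :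
    ∫ ω, (∏ k ∈ U, X k ω) * ∏ k ∈ V, (1 - X k ω) ∂μ = p ^ #U * (1 - p) ^ #V := by
  have split (u v : ι → ℝ) : (∏ k ∈ U, u k) * ∏ k ∈ V, v k =
      ∏ k, if k ∈ U then u k else if k ∈ V then v k else 1 := by
    rw [← prod_subset (subset_univ (U ∪ V)) (by simp +contextual), prod_union hUV]
    congr 1
    · exact prod_congr rfl fun k hk => by simp [hk]
    · exact prod_congr rfl fun k hk => by simp [hk, disjoint_right.1 hUV hk]
  let φ : ι → ℝ → ℝ := fun k x => if k ∈ U then x else if k ∈ V then 1 - x else 1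
  have hφ : ∀ k, Measurable (φ k) := by
    intro k
    dsimp only [φ]
    split_ifs <;> fun_prop
  calc ∫ ω, (∏ k ∈ U, X k ω) * ∏ k ∈ V, (1 - X k ω) ∂μ
      = ∫ ω, ∏ k, φ k (X k ω) ∂μ := by simp only [split, φ]
    _ = ∏ k, ∫ ω, φ k (X k ω) ∂μ :=
      hind.integral_fun_prod_comp (fun k => (hX k).aemeasurable)
        (fun k => (hφ k).aestronglyMeasurable)
    _ = ∏ k, if k ∈ U then p else if k ∈ V then 1 - p else 1 := by
      refine prod_congr rfl fun k _ => ?_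
      dsimp only [φ]
      split_ifs
      · exact hmean k
      · rw [integral_sub (integrable_const _) (hint k), hmean]; simp
      · simp
    _ = p ^ #U * (1 - p) ^ #V := by rw [← split]; simp

lemma integral_mul_mul_comp_sum (hind : iIndepFun X μ) (hX : ∀ k, Measurable (X k))
    (hX01 : ∀ k ω, X k ω = 0 ∨ X k ω = 1) (hmean : ∀ k, ∫ ω, X k ω ∂μ = p)
    {m : ℕ} (hcard : Fintype.card ι = m + 2) {u v : ι} (huv : u ≠ v) (g : ℝ → ℝ) :
    ∫ ω, X u ω * X v ω * g (∑ k, X k ω) ∂μ =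
      ∑ k ∈ range (m + 1), (m.choose k : ℝ) * (g (k + 2) * (p ^ (k + 2) * (1 - p) ^ (m - k))) := by
  have hbound (k : ι) (ω : Ω) : ‖X k ω‖ ≤ 1 ∧ ‖1 - X k ω‖ ≤ 1 := by
    rcases hX01 k ω with h | h <;> simp [h]
  have hint (k : ι) : Integrable (X k) μ :=
    .of_bound (hX k).aestronglyMeasurable 1 (.of_forall fun ω => (hbound k ω).1)
  set R : Finset ι := (univ.erase u).erase v with hR
  have hv : v ∉ R := by simp [hR]
  have hu : u ∉ insert v R := by simp [hR, huv]
  have huniv : insert u (insert v R) = univ := by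
    rw [hR, insert_erase (by simp [huv.symm]), insert_erase (mem_univ u)]
  have hRcard : #R = m := by
    have h := congrArg Finset.card huniv
    rw [card_insert_of_notMem hu, card_insert_of_notMem hv, card_univ, hcard] at h
    omega
  have hpoint (ω : Ω) : X u ω * X v ω * g (∑ k, X k ω) =
      ∑ T ∈ R.powerset, g (#T + 2) *
        ((∏ k ∈ insert u (insert v T), X k ω) * ∏ k ∈ R \ T, (1 - X k ω)) := by
    have key : X u ω * X v ω * g (∑ k, X k ω) =
        X u ω * X v ω * g (∑ k ∈ R, X k ω + 2) := by
      rw [← huniv, sum_insert hu, sum_insert hv]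
      rcases hX01 u ω with h | h
      · simp [h]
      rcases hX01 v ω with h' | h'
      · simp [h']
      rw [h, h']
      congr 2
      ring
    rw [key, sum_zero_one_eq_sum_powerset R _ (fun k _ => hX01 k ω) (fun y => g (y + 2)), mul_sum]
    refine sum_congr rfl fun T hT => ?_
    have hTR := mem_powerset.1 hT
    rw [prod_insert fun h => hu (insert_subset_insert v hTR h), prod_insert fun h => hv (hTR h)]
    ring
  have hprodint (U V : Finset ι) :
      Integrable (fun ω => (∏ k ∈ U, X k ω) * ∏ k ∈ V, (1 - X k ω)) μ := by
    refine .of_bound (Measurable.aestronglyMeasurable (by fun_prop)) 1 (.of_forall fun ω => ?_)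
    rw [norm_mul, norm_prod, norm_prod]
    exact mul_le_one₀ (prod_le_one (fun _ _ => norm_nonneg _) fun k _ => (hbound k ω).1)
      (prod_nonneg fun _ _ => norm_nonneg _)
      (prod_le_one (fun _ _ => norm_nonneg _) fun k _ => (hbound k ω).2)
  simp_rw [hpoint]
  rw [integral_finsetSum _ fun T _ => (hprodint _ _).const_mul _]
  have hterm : ∀ T ∈ R.powerset, ∫ ω, g (#T + 2) *
      ((∏ k ∈ insert u (insert v T), X k ω) * ∏ k ∈ R \ T, (1 - X k ω)) ∂μ =
      g (#T + 2) * (p ^ (#T + 2) * (1 - p) ^ (m - #T)) := by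
    intro T hT
    have hTR := mem_powerset.1 hT
    have hdisj : Disjoint (insert u (insert v T)) (R \ T) := by
      rw [disjoint_insert_left, disjoint_insert_left]
      refine ⟨fun h => hu (mem_insert_of_mem (mem_sdiff.1 h).1), fun h => hv (mem_sdiff.1 h).1,
        disjoint_sdiff⟩
    rw [integral_const_mul, integral_prod_mul_prod_one_sub hind hX hint hmean hdisj,
      card_insert_of_notMem fun h => hu (insert_subset_insert v hTR h),
      card_insert_of_notMem fun h => hv (hTR h), card_sdiff_of_subset hTR, hRcard]
  rw [sum_congr rfl hterm,
    sum_powerset_apply_card fun k => g (k + 2) * (p ^ (k + 2) * (1 - p) ^ (m - k)), hRcard]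
  simp only [nsmul_eq_mul]

end Bernoulli

lemma sum_choose_mul_pow_div_add_one (N : ℕ) {p q : ℝ} (hp : p ≠ 0) :
    ∑ k ∈ range (N + 1), (N.choose k : ℝ) * p ^ k * q ^ (N - k) / (k + 1) =
      ((p + q) ^ (N + 1) - q ^ (N + 1)) / ((N + 1) * p) := by
  have hN : (N : ℝ) + 1 ≠ 0 := by positivity
  rw [eq_div_iff (by positivity), add_pow, sum_mul, sum_range_succ' _ (N + 1)]
  simp only [pow_zero, Nat.choose_zero_right, Nat.sub_zero, Nat.cast_one, one_mul, mul_one,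
    add_sub_cancel_right]
  refine sum_congr rfl fun k _ => ?_
  have h : ((N : ℝ) + 1) * N.choose k = (N + 1).choose (k + 1) * (k + 1) := by
    exact_mod_cast Nat.add_one_mul_choose_eq N k
  have hk : (k : ℝ) + 1 ≠ 0 := by positivity
  rw [Nat.add_sub_add_right, div_mul_eq_mul_div, div_eq_iff hk]
  linear_combination p ^ (k + 1) * q ^ (N - k) * h

lemma sum_choose_div_add_three_sq (m : ℕ) {p q : ℝ} (hp : p ≠ 0) (hpq : p + q = 1) :
    ((m : ℝ) + 2) * (m + 1) * ∑ k ∈ range (m + 1),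
        (m.choose k : ℝ) * (1 / ((k + 2 : ℝ) + 1) ^ 2 * (p ^ (k + 2) * q ^ (m - k))) =
      1 + 2 * ∑ k ∈ range (m + 3),
          ((m + 2).choose k : ℝ) * p ^ k * q ^ (m + 2 - k) / ((k : ℝ) + 1) ^ 2
        - 3 * ((1 - q ^ (m + 3)) / ((m + 3) * p)) := by
  have hone : ∑ k ∈ range (m + 3), ((m + 2).choose k : ℝ) * p ^ k * q ^ (m + 2 - k) = 1 := by
    have h := add_pow p q (m + 2)
    rw [hpq, one_pow] at h
    rw [h]
    exact sum_congr rfl fun k _ => by ring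
  have hinv := sum_choose_mul_pow_div_add_one (m + 2) (q := q) hp
  rw [hpq, one_pow] at hinv
  have hcast : (((m + 2 : ℕ) : ℝ) + 1) = m + 3 := by push_cast; ring
  rw [hcast] at hinv
  have hshift : ((m : ℝ) + 2) * (m + 1) * ∑ k ∈ range (m + 1),
        (m.choose k : ℝ) * (1 / ((k + 2 : ℝ) + 1) ^ 2 * (p ^ (k + 2) * q ^ (m - k))) =
      ∑ k ∈ range (m + 3), ((m + 2).choose k : ℝ) * p ^ k * q ^ (m + 2 - k) *
        (k * (k - 1) / ((k : ℝ) + 1) ^ 2) := by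
    rw [mul_sum, sum_range_succ' _ (m + 2), sum_range_succ' _ (m + 1)]
    simp only [Nat.cast_zero, Nat.cast_one, zero_mul, zero_div, mul_zero, add_zero, zero_add,
      sub_self]
    refine sum_congr rfl fun k _ => ?_
    have h₁ : ((m : ℝ) + 1) * m.choose k = (m + 1).choose (k + 1) * (k + 1) := by
      exact_mod_cast Nat.add_one_mul_choose_eq m k
    have h₂ : ((m : ℝ) + 2) * (m + 1).choose (k + 1) = (m + 2).choose (k + 2) * (k + 2) := by
      exact_mod_cast Nat.add_one_mul_choose_eq (m + 1) (k + 1)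
    have h₃ : ((m : ℝ) + 2) * (m + 1) * m.choose k =
        (m + 2).choose (k + 2) * (k + 2) * (k + 1) := by
      linear_combination (m + 2 : ℝ) * h₁ + (k + 1 : ℝ) * h₂
    have hsub : m + 2 - (k + 1 + 1) = m - k := by omega
    rw [hsub]
    push_cast
    linear_combination (1 / ((k + 2 : ℝ) + 1) ^ 2 * (p ^ (k + 2) * q ^ (m - k))) * h₃
  have hsplit : ∑ k ∈ range (m + 3), ((m + 2).choose k : ℝ) * p ^ k * q ^ (m + 2 - k) *
        (k * (k - 1) / ((k : ℝ) + 1) ^ 2) =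
      ∑ k ∈ range (m + 3), ((m + 2).choose k : ℝ) * p ^ k * q ^ (m + 2 - k) +
        2 * ∑ k ∈ range (m + 3),
          ((m + 2).choose k : ℝ) * p ^ k * q ^ (m + 2 - k) / ((k : ℝ) + 1) ^ 2 -
        3 * ∑ k ∈ range (m + 3),
          ((m + 2).choose k : ℝ) * p ^ k * q ^ (m + 2 - k) / ((k : ℝ) + 1) := by
    rw [mul_sum, mul_sum, ← sum_add_distrib, ← sum_sub_distrib]
    refine sum_congr rfl fun k _ => ?_
    have hk : (k : ℝ) + 1 ≠ 0 := by positivity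
    field_simp
    ring
  rw [hshift, ← hinv, hsplit, hone]

/-- For three distinct vertices `i, j, s`,
`E[a_{ij} a_{is}/(d_i+1)²] = (1 + 2 q^{n-1} H(p,n) - 3 f₁(p,n)) / ((n-1)(n-2))`. -/
theorem expected_aij_ais_over_degree_squared
    {Ω : Type*} [MeasurableSpace Ω] (μ : Measure Ω) [IsProbabilityMeasure μ]
    (n : ℕ) (hn : 3 ≤ n) (p q : ℝ) (hp : p ∈ Set.Ioo (0 : ℝ) 1) (hq : q = 1 - p)
    (a : Fin n → Fin n → Ω → ℝ)
    (ha01 : ∀ i j ω, a i j ω = 0 ∨ a i j ω = 1)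
    (hdiag : ∀ i ω, a i i ω = 0)
    (hmeas : ∀ i j, Measurable (a i j))
    (hber : ∀ i j, i ≠ j → μ {ω | a i j ω = 1} = ENNReal.ofReal p)
    (hind : iIndepFun (m := fun _ => Real.measurableSpace)
      (fun ij : {ij : Fin n × Fin n // ij.1 ≠ ij.2} => a ij.1.1 ij.1.2) μ)
    (d : Fin n → Ω → ℝ) (hd : ∀ i ω, d i ω = ∑ j, a i j ω)
    (f₁ : ℝ) (hf₁ : f₁ = (1 - q ^ n) / (n * p))
    (H : ℝ)
    (hH : H = ∑ k ∈ Finset.range n,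
      (1 / ((k : ℝ) + 1) ^ 2) * ((n - 1).choose k : ℝ) * (p / q) ^ k)
    (i j s : Fin n) (hij : i ≠ j) (his : i ≠ s) (hjs : j ≠ s) :
    (∫ ω, a i j ω * a i s ω / (d i ω + 1) ^ 2 ∂μ)
      = (1 + 2 * q ^ (n - 1) * H - 3 * f₁) / ((n - 1) * (n - 2)) := by
  obtain ⟨m, rfl⟩ : ∃ m, n = m + 3 := ⟨n - 3, by omega⟩
  have hp0 : p ≠ 0 := hp.1.ne'
  have hq0 : q ≠ 0 := by rw [hq]; exact (sub_pos.2 hp.2).ne'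
  let X : {k // k ≠ i} → Ω → ℝ := fun k => a i k
  have hX : ∀ k, Measurable (X k) := fun k => hmeas i k
  have hXind : iIndepFun X μ :=
    hind.precomp (g := fun k : {k // k ≠ i} => ⟨(i, k.1), k.2.symm⟩) fun k l h => by
      simpa [Subtype.ext_iff] using h
  have hmean (k : {k // k ≠ i}) : ∫ ω, X k ω ∂μ = p := by
    have hind1 : X k = {ω | a i k ω = 1}.indicator 1 := by
      funext ω
      rcases ha01 i k ω with h | h <;> simp [X, h]
    have hset : MeasurableSet {ω | a i k ω = 1} := hmeas i k (measurableSet_singleton 1)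
    rw [hind1, integral_indicator_one hset, Measure.real,
      hber i k k.2.symm, ENNReal.toReal_ofReal hp.1.le]
  have hdeg (ω : Ω) : d i ω = ∑ k, X k ω := by
    rw [hd, Fintype.sum_eq_add_sum_subtype_ne _ i, hdiag, zero_add]
  have hcard : Fintype.card {k // k ≠ i} = m + 2 := by
    simp [Fintype.card_subtype_compl]
  have hE := integral_mul_mul_comp_sum hXind hX (fun k ω => ha01 i k ω) hmean hcard
    (u := ⟨j, hij.symm⟩) (v := ⟨s, his.symm⟩) (by simpa using hjs) (fun y => 1 / (y + 1) ^ 2)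
  have hHsum : q ^ (m + 2) * H = ∑ k ∈ range (m + 3),
      ((m + 2).choose k : ℝ) * p ^ k * q ^ (m + 2 - k) / ((k : ℝ) + 1) ^ 2 := by
    rw [hH, mul_sum]
    refine sum_congr rfl fun k hk => ?_
    have hle : k ≤ m + 2 := by have := mem_range.1 hk; omega
    rw [div_pow, pow_sub₀ q hq0 hle, Nat.add_sub_assoc (by norm_num)]
    ring
  have hmain := sum_choose_div_add_three_sq m hp0 (show p + q = 1 by rw [hq]; ring)
  rw [← hq] at hE
  have hint : ∫ ω, a i j ω * a i s ω / (d i ω + 1) ^ 2 ∂μ =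
      ∫ ω, X ⟨j, hij.symm⟩ ω * X ⟨s, his.symm⟩ ω * (1 / (∑ k, X k ω + 1) ^ 2) ∂μ := by
    simp only [hdeg, mul_one_div, X]
  have h₁ : ((m + 3 : ℕ) : ℝ) - 1 = m + 2 := by push_cast; ring
  have h₂ : ((m + 3 : ℕ) : ℝ) - 2 = m + 1 := by push_cast; ring
  rw [hint, hE, h₁, h₂, eq_div_iff (by positivity), mul_comm, hmain, hf₁, ← hHsum,
    Nat.add_sub_assoc (by norm_num)]
  push_cast
  ring
end

section
/- For any vertices i, r, s with i ≠ r and s ≠ r, E[w_{ii} w_{rs}] = f_1(p,n) · (1 - f_1(p,n))/(n-1). (This covers both the case s = i and the case where i, r, s are all distinct.) -/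
open MeasureTheory ProbabilityTheory Finset

section BernoulliSums

lemma integral_eq_of_zero_or_one {Ω : Type*} [MeasurableSpace Ω] {μ : Measure Ω} {p : ℝ}
    {Y : Ω → ℝ} (h01 : ∀ ω, Y ω = 0 ∨ Y ω = 1)
    (hY : Measurable Y) (hp : 0 ≤ p) (h : μ {ω | Y ω = 1} = ENNReal.ofReal p) :
    ∫ ω, Y ω ∂μ = p := by
  have hset : MeasurableSet {ω | Y ω = 1} := hY (measurableSet_singleton 1)
  have heq : Y = {ω | Y ω = 1}.indicator 1 := by
    funext ω
    rcases h01 ω with h | h <;> simp [Set.indicator, h]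
  rw [heq, integral_indicator_one hset, measureReal_def, h, ENNReal.toReal_ofReal hp]

lemma sum_nonneg_of_zero_or_one {Ω ι : Type*} {X : ι → Ω → ℝ}
    (h01 : ∀ i ω, X i ω = 0 ∨ X i ω = 1) (S : Finset ι) (ω : Ω) :
    0 ≤ ∑ i ∈ S, X i ω :=
  Finset.sum_nonneg fun i _ => by rcases h01 i ω with h | h <;> simp [h]

variable {Ω ι : Type*} [MeasurableSpace Ω] {μ : Measure Ω} {X : ι → Ω → ℝ} {p : ℝ}

lemma indepFun_one_div_sum_add_one_of_disjoint (hX : ∀ i, Measurable (X i)) (hind : iIndepFun X μ)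
    {S T : Finset ι} (hST : Disjoint S T) {t : ι} (ht : t ∈ T) :
    IndepFun (fun ω => 1 / (∑ i ∈ S, X i ω + 1)) (fun ω => X t ω / (∑ i ∈ T, X i ω + 1)) μ := by
  have h := (hind.indepFun_finset S T hST hX).comp
    (φ := fun x : S → ℝ => 1 / (∑ i, x i + 1))
    (ψ := fun x : T → ℝ => x ⟨t, ht⟩ / (∑ i, x i + 1)) (by fun_prop) (by fun_prop)
  convert h using 1
  · funext ω
    simp only [Function.comp_apply, Finset.sum_coe_sort S (fun i => X i ω)]
  · funext ω
    simp only [Function.comp_apply, Finset.sum_coe_sort T (fun i => X i ω)]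

variable [IsProbabilityMeasure μ]

lemma integrable_one_div_sum_add_one (h01 : ∀ i ω, X i ω = 0 ∨ X i ω = 1)
    (hX : ∀ i, Measurable (X i)) (S : Finset ι) :
    Integrable (fun ω => 1 / (∑ i ∈ S, X i ω + 1)) μ := by
  refine Integrable.of_bound (C := 1) (Measurable.aestronglyMeasurable (by fun_prop))
    (.of_forall fun ω => ?_)
  have h := sum_nonneg_of_zero_or_one h01 S ω
  rw [Real.norm_of_nonneg (by positivity)]
  exact div_le_one_of_le₀ (by linarith) (by linarith)

lemma integral_div_sum_add_one_s6 [DecidableEq ι] (h01 : ∀ i ω, X i ω = 0 ∨ X i ω = 1)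
    (hX : ∀ i, Measurable (X i)) (hind : iIndepFun X μ) (hE : ∀ i, ∫ ω, X i ω ∂μ = p)
    (S : Finset ι) {s : ι} (hs : s ∈ S) :
    ∫ ω, X s ω / (∑ i ∈ S, X i ω + 1) ∂μ
      = ∫ ω, 1 / (∑ i ∈ S, X i ω + 1) ∂μ
        - (1 - p) * ∫ ω, 1 / (∑ i ∈ S.erase s, X i ω + 1) ∂μ := by
  have hXint : Integrable (X s) μ := by
    refine Integrable.of_bound (C := 1) (hX s).aestronglyMeasurable (.of_forall fun ω => ?_)
    rcases h01 s ω with h | h <;> simp [h]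
  have hpt : ∀ ω, X s ω / (∑ i ∈ S, X i ω + 1)
      = 1 / (∑ i ∈ S, X i ω + 1) - (1 - X s ω) * (1 / (∑ i ∈ S.erase s, X i ω + 1)) := by
    intro ω
    rw [← Finset.add_sum_erase S (fun i => X i ω) hs]
    rcases h01 s ω with h | h <;> simp [h]
  have hindep : IndepFun (fun ω => 1 - X s ω)
      (fun ω => 1 / (∑ i ∈ S.erase s, X i ω + 1)) μ := by
    have h := (hind.indepFun_finsetSum_of_notMem hX (Finset.notMem_erase s S)).symm
    have h2 := h.comp (φ := fun x : ℝ => 1 - x) (ψ := fun x : ℝ => 1 / (x + 1))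
      (by fun_prop) (by fun_prop)
    simpa [Function.comp_def, Finset.sum_apply] using h2
  have hint := integrable_one_div_sum_add_one (μ := μ) h01 hX (S.erase s)
  have hX' : Integrable (fun ω => 1 - X s ω) μ := (integrable_const 1).sub hXint
  have hmul : Integrable (fun ω => (1 - X s ω) * (1 / (∑ i ∈ S.erase s, X i ω + 1))) μ :=
    hindep.integrable_mul hX' hint
  simp_rw [hpt]
  rw [integral_sub (integrable_one_div_sum_add_one h01 hX S) hmul,
    hindep.integral_fun_mul_eq_mul_integral hX'.aestronglyMeasurable hint.aestronglyMeasurable,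
    integral_sub (integrable_const 1) hXint, hE]
  simp

lemma card_add_one_mul_integral_one_div_sum_add_one [DecidableEq ι]
    (h01 : ∀ i ω, X i ω = 0 ∨ X i ω = 1)
    (hX : ∀ i, Measurable (X i)) (hind : iIndepFun X μ) (hE : ∀ i, ∫ ω, X i ω ∂μ = p)
    (S : Finset ι) :
    p * ((#S + 1) * ∫ ω, 1 / (∑ i ∈ S, X i ω + 1) ∂μ) = 1 - (1 - p) ^ (#S + 1) := by
  induction hm : #S generalizing S with
  | zero => simp [Finset.card_eq_zero.mp hm]
  | succ m ih =>
    have hint := integrable_one_div_sum_add_one (μ := μ) h01 hX S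
    have hdiv : ∀ s ∈ S, Integrable (fun ω => X s ω / (∑ i ∈ S, X i ω + 1)) μ := by
      intro s _
      refine hint.mono (Measurable.aestronglyMeasurable (by fun_prop)) (.of_forall fun ω => ?_)
      rcases h01 s ω with h | h <;> simp [h]
    have hsum : 1 - ∫ ω, 1 / (∑ i ∈ S, X i ω + 1) ∂μ
        = ∑ s ∈ S, ∫ ω, X s ω / (∑ i ∈ S, X i ω + 1) ∂μ := by
      have hone : (1 : ℝ) = ∫ _, (1 : ℝ) ∂μ := by simp
      rw [← integral_finsetSum S hdiv]
      nth_rewrite 1 [hone]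
      rw [← integral_sub (integrable_const 1) hint]
      refine integral_congr_ae (.of_forall fun ω => ?_)
      have h := sum_nonneg_of_zero_or_one h01 S ω
      have h' : ∑ i ∈ S, X i ω + 1 ≠ 0 := by linarith
      simp only [← Finset.sum_div]
      field_simp
      ring
    have hterm : ∀ s ∈ S, p * ((m + 1) * ∫ ω, X s ω / (∑ i ∈ S, X i ω + 1) ∂μ)
        = p * ((m + 1) * ∫ ω, 1 / (∑ i ∈ S, X i ω + 1) ∂μ)
          - (1 - p) * (1 - (1 - p) ^ (m + 1)) := by
      intro s hs
      rw [integral_div_sum_add_one_s6 h01 hX hind hE S hs,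
        ← ih (S.erase s) (by rw [Finset.card_erase_of_mem hs, hm]; rfl)]
      ring
    have htot := congrArg (fun x => p * ((m + 1) * x)) hsum
    simp only [Finset.mul_sum] at htot
    rw [Finset.sum_congr rfl hterm, Finset.sum_const, hm, nsmul_eq_mul] at htot
    push_cast at htot ⊢
    have hm0 : (m : ℝ) + 1 ≠ 0 := by positivity
    apply mul_left_cancel₀ hm0
    linear_combination -htot

end BernoulliSums

/-- The off-diagonal positions in row `i`. -/
def offDiagRow {n : ℕ} (i : Fin n) : Finset {ij : Fin n × Fin n // ij.1 ≠ ij.2} :=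
  (univ : Finset {j : Fin n // i ≠ j}).map
    ⟨fun j => ⟨(i, j.1), j.2⟩, fun j k h => by simpa [Subtype.ext_iff] using h⟩

lemma mem_offDiagRow {n : ℕ} {i : Fin n} {x : {ij : Fin n × Fin n // ij.1 ≠ ij.2}} :
    x ∈ offDiagRow i ↔ x.1.1 = i := by
  simp only [offDiagRow, mem_map, mem_univ, true_and]
  constructor
  · rintro ⟨j, rfl⟩
    rfl
  · rintro rfl
    exact ⟨⟨x.1.2, x.2⟩, rfl⟩

lemma card_offDiagRow {n : ℕ} (i : Fin n) : #(offDiagRow i) = n - 1 := by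
  simp [offDiagRow, Fintype.card_subtype_compl]

lemma sum_offDiagRow {n : ℕ} (i : Fin n) (f : Fin n → Fin n → ℝ) (hf : f i i = 0) :
    ∑ x ∈ offDiagRow i, f x.1.1 x.1.2 = ∑ j, f i j := by
  rw [offDiagRow, sum_map, ← Finset.sum_erase univ hf]
  exact (Finset.sum_subtype (univ.erase i) (by simp [eq_comm]) (f i)).symm

/-- For vertices `i, r, s` with `i ≠ r` and `s ≠ r`,
`E[w_{ii} w_{rs}] = f₁(p,n)·(1-f₁(p,n))/(n-1)` (this covers both the case `s = i` and
the case where `i, r, s` are all distinct). -/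
theorem expected_wii_wrs
    {Ω : Type*} [MeasurableSpace Ω] (μ : Measure Ω) [IsProbabilityMeasure μ]
    (n : ℕ) (hn : 2 ≤ n) (p q : ℝ) (hp : p ∈ Set.Ioc (0 : ℝ) 1) (hq : q = 1 - p)
    (a : Fin n → Fin n → Ω → ℝ)
    (ha01 : ∀ i j ω, a i j ω = 0 ∨ a i j ω = 1)
    (hdiag : ∀ i ω, a i i ω = 0)
    (hmeas : ∀ i j, Measurable (a i j))
    (hber : ∀ i j, i ≠ j → μ {ω | a i j ω = 1} = ENNReal.ofReal p)
    (hind : iIndepFun (m := fun _ => Real.measurableSpace)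
      (fun ij : {ij : Fin n × Fin n // ij.1 ≠ ij.2} => a ij.1.1 ij.1.2) μ)
    (d : Fin n → Ω → ℝ) (hd : ∀ i ω, d i ω = ∑ j, a i j ω)
    (f₁ : ℝ) (hf₁ : f₁ = (1 - q ^ n) / (n * p))
    (i r s : Fin n) (hir : i ≠ r) (hsr : s ≠ r) :
    (∫ ω, (1 / (d i ω + 1)) * (a r s ω / (d r ω + 1)) ∂μ)
      = f₁ * (1 - f₁) / (n - 1) := by
  have hE : ∀ x : {ij : Fin n × Fin n // ij.1 ≠ ij.2}, ∫ ω, a x.1.1 x.1.2 ω ∂μ = p := fun x =>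
    integral_eq_of_zero_or_one (ha01 _ _) (hmeas _ _) hp.1.le (hber _ _ x.2)
  have h01 : ∀ (x : {ij : Fin n × Fin n // ij.1 ≠ ij.2}) ω,
      a x.1.1 x.1.2 ω = 0 ∨ a x.1.1 x.1.2 ω = 1 := fun x => ha01 _ _
  have hX : ∀ x : {ij : Fin n × Fin n // ij.1 ≠ ij.2}, Measurable (a x.1.1 x.1.2) :=
    fun x => hmeas _ _
  have hd' : ∀ k ω, d k ω = ∑ x ∈ offDiagRow k, a x.1.1 x.1.2 ω := fun k ω => by
    rw [hd, sum_offDiagRow k (fun i j => a i j ω) (hdiag k ω)]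
  have hrs : (⟨(r, s), hsr.symm⟩ : {ij : Fin n × Fin n // ij.1 ≠ ij.2}) ∈ offDiagRow r :=
    mem_offDiagRow.mpr rfl
  have hdisj : Disjoint (offDiagRow i) (offDiagRow r) :=
    Finset.disjoint_left.mpr fun x hi hr =>
      hir ((mem_offDiagRow.mp hi).symm.trans (mem_offDiagRow.mp hr))
  have hindep := indepFun_one_div_sum_add_one_of_disjoint hX hind hdisj hrs
  have hmul := hindep.integral_fun_mul_eq_mul_integral
    (Measurable.aestronglyMeasurable (by fun_prop)) (Measurable.aestronglyMeasurable (by fun_prop))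
  have hdiv := integral_div_sum_add_one_s6 h01 hX hind hE (offDiagRow r) hrs
  have hi := card_add_one_mul_integral_one_div_sum_add_one h01 hX hind hE (offDiagRow i)
  have hr := card_add_one_mul_integral_one_div_sum_add_one h01 hX hind hE (offDiagRow r)
  have he := card_add_one_mul_integral_one_div_sum_add_one h01 hX hind hE
    ((offDiagRow r).erase ⟨(r, s), hsr.symm⟩)
  rw [Finset.card_erase_of_mem hrs] at he
  rw [card_offDiagRow] at hi hr he
  simp_rw [hd']
  rw [hmul, hdiv]
  obtain ⟨m, rfl⟩ := Nat.exists_eq_add_of_le' hn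
  have hp0 : p ≠ 0 := hp.1.ne'
  have hm1 : (m : ℝ) + 1 ≠ 0 := by positivity
  have hm2 : (m : ℝ) + 2 ≠ 0 := by positivity
  simp only [Nat.add_sub_cancel, show m + 2 - 1 = m + 1 from rfl] at hi hr he
  push_cast at hi hr he ⊢
  have solve : ∀ {c x y : ℝ}, c ≠ 0 → p * (c * x) = y → x = y / (c * p) := by
    intro c x y hc h
    rw [← h]
    field_simp
  have hm2' : (m : ℝ) + 1 + 1 ≠ 0 := by positivity
  rw [solve hm2' hi, solve hm2' hr, solve hm1 he, hf₁, hq]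
  push_cast
  have hm3 : (m : ℝ) + 2 - 1 = m + 1 := by ring
  have hm4 : (m : ℝ) + 1 + 1 = m + 2 := by ring
  rw [hm3, hm4]
  field_simp
  ring
end

section
/- The expected weight matrix satisfies, entrywise, E[W] = ((1 - f_1(p,n))/(n-1)) · 1_n 1_n^T + ((n f_1(p,n) - 1)/(n-1)) · I_n, where 1_n is the all-ones column vector and I_n the identity matrix; that is, E[w_{ii}] = f_1(p,n) for every i and E[w_{ij}] = (1 - f_1(p,n))/(n-1) for every j ≠ i. -/
open MeasureTheory ProbabilityTheory Finset

section BernoulliSums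

variable {Ω ι : Type*} [MeasurableSpace Ω] {μ : Measure Ω}
  {p : ℝ} {X : ι → Ω → ℝ}

/-- The mean of a `{0, 1}`-valued random variable is its probability of being `1`. -/
lemma integral_of_zero_or_one {Y : Ω → ℝ} (hp : 0 ≤ p) (hY : Measurable Y)
    (h01 : ∀ ω, Y ω = 0 ∨ Y ω = 1) (hb : μ {ω | Y ω = 1} = ENNReal.ofReal p) :
    ∫ ω, Y ω ∂μ = p := by
  have h : Y = Set.indicator {ω | Y ω = 1} 1 := by
    ext ω
    rcases h01 ω with h | h <;> simp [Set.indicator, h]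
  have hm : MeasurableSet {ω | Y ω = 1} := hY (measurableSet_singleton 1)
  calc ∫ ω, Y ω ∂μ = ∫ ω, Set.indicator {ω | Y ω = 1} 1 ω ∂μ := by rw [← h]
    _ = p := by rw [integral_indicator_one hm, Measure.real, hb, ENNReal.toReal_ofReal hp]

lemma integrable_mul_of_zero_or_one {Y Z : Ω → ℝ} (hY : Measurable Y)
    (h01 : ∀ ω, Y ω = 0 ∨ Y ω = 1) (hZ : Integrable Z μ) :
    Integrable (fun ω => Y ω * Z ω) μ := by
  refine hZ.bdd_mul (c := 1) hY.aestronglyMeasurable (ae_of_all _ fun ω => ?_)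
  rcases h01 ω with h | h <;> simp [h]

lemma integral_mul_comp_sum (hp : 0 ≤ p) (hmeas : ∀ i, Measurable (X i))
    (h01 : ∀ i ω, X i ω = 0 ∨ X i ω = 1)
    (hb : ∀ i, μ {ω | X i ω = 1} = ENNReal.ofReal p) (hind : iIndepFun X μ)
    {s : Finset ι} {j : ι} (hj : j ∉ s) {g : ℝ → ℝ} (hg : Measurable g) :
    ∫ ω, X j ω * g (∑ i ∈ s, X i ω) ∂μ = p * ∫ ω, g (∑ i ∈ s, X i ω) ∂μ := by
  have hi : IndepFun (X j) (fun ω => g (∑ i ∈ s, X i ω)) μ := by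
    have h := (hind.indepFun_finsetSum_of_notMem hmeas hj).symm.comp measurable_id hg
    rw [Function.id_comp] at h
    simpa only [Function.comp_def, Finset.sum_apply] using h
  have hS : Measurable fun ω => g (∑ i ∈ s, X i ω) :=
    hg.comp (Finset.measurable_sum s fun i _ => hmeas i)
  rw [hi.integral_fun_mul_eq_mul_integral (hmeas j).aestronglyMeasurable
    hS.aestronglyMeasurable, integral_of_zero_or_one hp (hmeas j) (h01 j) (hb j)]

/-- A sum of independent Bernoulli variables has a binomial law. -/
lemma integral_comp_sum_eq_binomial [IsProbabilityMeasure μ] (hp : 0 ≤ p)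
    (hmeas : ∀ i, Measurable (X i)) (h01 : ∀ i ω, X i ω = 0 ∨ X i ω = 1)
    (hb : ∀ i, μ {ω | X i ω = 1} = ENNReal.ofReal p) (hind : iIndepFun X μ)
    (s : Finset ι) (g : ℝ → ℝ) (hg : Measurable g) :
    Integrable (fun ω => g (∑ i ∈ s, X i ω)) μ ∧
    ∫ ω, g (∑ i ∈ s, X i ω) ∂μ =
      ∑ k ∈ range (#s + 1), ((#s).choose k : ℝ) * (p ^ k * (1 - p) ^ (#s - k) * g k) := by
  classical
  induction s using Finset.induction_on generalizing g with
  | empty => simp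
  | insert j s hj ih =>
    have hg' : Measurable fun x => g (x + 1) := hg.comp (measurable_id.add_const 1)
    obtain ⟨hi, he⟩ := ih g hg
    obtain ⟨hi', he'⟩ := ih _ hg'
    have hsplit : (fun ω => g (∑ i ∈ insert j s, X i ω)) = fun ω =>
        (g (∑ i ∈ s, X i ω) - X j ω * g (∑ i ∈ s, X i ω))
          + X j ω * g (∑ i ∈ s, X i ω + 1) := by
      ext ω
      rw [sum_insert hj]
      rcases h01 j ω with h | h <;> simp [h, add_comm]
    have hm := integrable_mul_of_zero_or_one (hmeas j) (h01 j) hi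
    have hm' := integrable_mul_of_zero_or_one (hmeas j) (h01 j) hi'
    rw [hsplit]
    refine ⟨(hi.sub hm).add hm', ?_⟩
    have hadd := integral_add (hi.sub hm) hm'
    simp only [Pi.sub_apply] at hadd
    rw [hadd, integral_sub hi hm,
      integral_mul_comp_sum hp hmeas h01 hb hind hj hg,
      integral_mul_comp_sum hp hmeas h01 hb hind hj hg', he, he', card_insert_of_notMem hj,
      Finset.sum_choose_succ_mul (fun k l => p ^ k * (1 - p) ^ l * g k) (#s),
      ← one_sub_mul, mul_sum, mul_sum]
    congr 1 <;> refine sum_congr rfl fun k hk => ?_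
    · rw [Nat.sub_add_comm (Nat.lt_succ_iff.mp (mem_range.mp hk)), pow_succ]
      ring
    · push_cast
      ring

end BernoulliSums

/-- The expectation of `1 / (K + 1)` for `K` binomial with parameters `m` and `p`. -/
lemma binomial_sum_inv_succ {p : ℝ} (hp : p ≠ 0) (m : ℕ) :
    ∑ k ∈ range (m + 1), (m.choose k : ℝ) * (p ^ k * (1 - p) ^ (m - k) * (1 / ((k : ℝ) + 1)))
      = (1 - (1 - p) ^ (m + 1)) / ((m + 1 : ℕ) * p) := by
  have hm : ((m + 1 : ℕ) : ℝ) ≠ 0 := by positivity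
  have h := add_pow p (1 - p) (m + 1)
  rw [sum_range_succ'] at h
  simp only [add_sub_cancel, one_pow, pow_zero, Nat.sub_zero, Nat.choose_zero_right, Nat.cast_one,
    one_mul, mul_one, Nat.add_sub_add_right] at h
  rw [eq_div_iff (mul_ne_zero hm hp), sub_eq_of_eq_add h, sum_mul]
  refine sum_congr rfl fun k _ => ?_
  have hc : ((m + 1 : ℕ) : ℝ) * m.choose k = (m + 1).choose (k + 1) * ((k : ℝ) + 1) := by
    exact_mod_cast Nat.add_one_mul_choose_eq m k
  have hk : (k : ℝ) + 1 ≠ 0 := by positivity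
  calc _ = (((m + 1 : ℕ) : ℝ) * m.choose k) * (p ^ (k + 1) * (1 - p) ^ (m - k)) / (k + 1) := by
        ring
    _ = _ := by rw [hc]; field_simp

/-- The expected weight matrix satisfies, entrywise,
`E[W] = ((1-f₁(p,n))/(n-1))·1ₙ1ₙᵀ + ((n f₁(p,n)-1)/(n-1))·Iₙ`; that is,
`E[w_{ii}] = f₁(p,n)` for every `i` and `E[w_{ij}] = (1-f₁(p,n))/(n-1)` for every `j ≠ i`. -/
theorem expected_weight_matrix
    {Ω : Type*} [MeasurableSpace Ω] (μ : Measure Ω) [IsProbabilityMeasure μ]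
    (n : ℕ) (hn : 2 ≤ n) (p q : ℝ) (hp : p ∈ Set.Ioc (0 : ℝ) 1) (hq : q = 1 - p)
    (a : Fin n → Fin n → Ω → ℝ)
    (ha01 : ∀ i j ω, a i j ω = 0 ∨ a i j ω = 1)
    (hdiag : ∀ i ω, a i i ω = 0)
    (hmeas : ∀ i j, Measurable (a i j))
    (hber : ∀ i j, i ≠ j → μ {ω | a i j ω = 1} = ENNReal.ofReal p)
    (hind : iIndepFun (m := fun _ => Real.measurableSpace)
      (fun ij : {ij : Fin n × Fin n // ij.1 ≠ ij.2} => a ij.1.1 ij.1.2) μ)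
    (d : Fin n → Ω → ℝ) (hd : ∀ i ω, d i ω = ∑ j, a i j ω)
    (W : Ω → Fin n → Fin n → ℝ)
    (hW : ∀ ω i j, W ω i j = if i = j then 1 / (d i ω + 1) else a i j ω / (d i ω + 1))
    (f₁ : ℝ) (hf₁ : f₁ = (1 - q ^ n) / (n * p)) :
    (Matrix.of fun i j => ∫ ω, W ω i j ∂μ)
        = ((1 - f₁) / (n - 1)) • (Matrix.of fun _ _ => (1 : ℝ))
          + ((n * f₁ - 1) / (n - 1)) • (1 : Matrix (Fin n) (Fin n) ℝ) ∧
    (∀ i, (∫ ω, W ω i i ∂μ) = f₁) ∧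
    (∀ i j, j ≠ i → (∫ ω, W ω i j ∂μ) = (1 - f₁) / (n - 1)) := by
  obtain ⟨hp0, -⟩ := hp
  have hn2 : (2 : ℝ) ≤ n := by exact_mod_cast hn
  have hn1 : (n : ℝ) - 1 ≠ 0 := by linarith
  have hrow (i : Fin n) : iIndepFun (fun j : {j : Fin n // j ≠ i} => a i j) μ :=
    hind.precomp (g := fun j : {j : Fin n // j ≠ i} =>
      (⟨(i, j.1), j.2.symm⟩ : {ij : Fin n × Fin n // ij.1 ≠ ij.2}))
      fun j k h => Subtype.ext (congrArg (fun x => x.1.2) h)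
  have hcard (i : Fin n) : #(univ : Finset {j : Fin n // j ≠ i}) = n - 1 := by
    rw [card_univ, Fintype.card_subtype_compl]
    simp
  have hdsum (i : Fin n) (ω : Ω) : d i ω = ∑ j : {j : Fin n // j ≠ i}, a i j ω := by
    rw [hd, Fintype.sum_eq_add_sum_subtype_ne _ i, hdiag, zero_add]
  have hg1 : Measurable fun x : ℝ => 1 / (x + 1) := by fun_prop
  have hg2 : Measurable fun x : ℝ => 1 / (x + 2) := by fun_prop
  have hWii (i : Fin n) : (fun ω => W ω i i) =
      fun ω => 1 / (∑ j : {j : Fin n // j ≠ i}, a i j ω + 1) := by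
    ext ω
    rw [hW, if_pos rfl, hdsum]
  have hWij (i j : Fin n) (hj : j ≠ i) : (fun ω => W ω i j) = fun ω => a i j ω *
      (1 / (∑ k ∈ (univ : Finset {j : Fin n // j ≠ i}).erase ⟨j, hj⟩, a i k ω + 2)) := by
    ext ω
    rw [hW, if_neg hj.symm, hdsum, ← add_sum_erase univ _ (mem_univ ⟨j, hj⟩)]
    rcases ha01 i j ω with h | h
    · simp [h]
    · simp only [h]
      ring
  have hdiag_int (i : Fin n) := integral_comp_sum_eq_binomial hp0.le
    (fun j : {j : Fin n // j ≠ i} => hmeas i j.1) (fun j => ha01 i j.1) (fun j => hber i j.1 j.2.symm) (hrow i) univ _ hg1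
  have hoff_int (i j : Fin n) (hj : j ≠ i) := integral_comp_sum_eq_binomial hp0.le
    (fun j : {j : Fin n // j ≠ i} => hmeas i j.1) (fun j => ha01 i j.1) (fun j => hber i j.1 j.2.symm) (hrow i)
    (univ.erase ⟨j, hj⟩) _ hg2
  have hii (i : Fin n) : ∫ ω, W ω i i ∂μ = f₁ := by
    rw [hWii, (hdiag_int i).2, hcard, binomial_sum_inv_succ hp0.ne', Nat.sub_add_cancel (by omega),
      hf₁, hq]
  have hintegrable (i j : Fin n) : Integrable (fun ω => W ω i j) μ := by
    by_cases hj : j = i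
    · subst hj
      rw [hWii]
      exact (hdiag_int j).1
    · rw [hWij i j hj]
      exact integrable_mul_of_zero_or_one (hmeas i j) (ha01 i j) (hoff_int i j hj).1
  obtain ⟨c, hc⟩ : ∃ c : ℝ, ∀ i j, j ≠ i → ∫ ω, W ω i j ∂μ = c := by
    refine ⟨p * ∑ k ∈ range (n - 1 - 1 + 1), ((n - 1 - 1).choose k : ℝ) *
      (p ^ k * (1 - p) ^ (n - 1 - 1 - k) * (1 / ((k : ℝ) + 2))), fun i j hj => ?_⟩
    rw [hWij i j hj, integral_mul_comp_sum hp0.le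
      (fun j : {j : Fin n // j ≠ i} => hmeas i j.1)
      (fun j => ha01 i j.1) (fun j => hber i j.1 j.2.symm) (hrow i)
      (notMem_erase (⟨j, hj⟩ : {j : Fin n // j ≠ i}) univ) hg2, (hoff_int i j hj).2,
      card_erase_of_mem (mem_univ _), hcard]
  have hrowsum (i : Fin n) (ω : Ω) : ∑ j, W ω i j = 1 := by
    have hd0 : 0 ≤ d i ω := by
      rw [hd]
      exact sum_nonneg fun j _ => by rcases ha01 i j ω with h | h <;> simp [h]
    rw [Fintype.sum_eq_add_sum_subtype_ne _ i, hW, if_pos rfl,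
      sum_congr rfl fun j _ => (hW ω i j.1).trans (if_neg j.2.symm), ← sum_div, ← hdsum]
    field_simp
    ring
  have hij (i j : Fin n) (hj : j ≠ i) : ∫ ω, W ω i j ∂μ = (1 - f₁) / (n - 1) := by
    have h : ∑ k, ∫ ω, W ω i k ∂μ = 1 := by
      rw [← integral_finsetSum _ fun k _ => hintegrable i k]
      simp [hrowsum]
    rw [Fintype.sum_eq_add_sum_subtype_ne _ i, hii, sum_congr rfl fun k _ => hc i k.1 k.2,
      sum_const, hcard, nsmul_eq_mul, Nat.cast_sub (by omega), Nat.cast_one] at h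
    rw [hc i j hj, eq_div_iff hn1]
    linarith
  refine ⟨?_, hii, hij⟩
  ext i j
  by_cases hj : j = i
  · subst hj
    simp only [Matrix.of_apply, Matrix.add_apply, Matrix.smul_apply, Matrix.one_apply_eq, hii,
      smul_eq_mul, mul_one]
    field_simp
    ring
  · simp [hij i j hj, Matrix.one_apply_ne (Ne.symm hj)]
end

section
/- The vector v ∈ ℝ^{n²} indexed by pairs (i,r), defined by v_{(i,r)} = ρ(p,n)/δ(p,n) if i ≠ r and v_{(i,i)} = 1/δ(p,n) (i.e., v = (1/δ)[ρ (1_n ⊗ 1_n) + (1-ρ) ∑_{i=1}^n e_i ⊗ e_i]), is a left eigenvector of E[W ⊗ W] associated with the unit eigenvalue: for every pair (j,s), ∑_{(i,r)} v_{(i,r)} E[w_{ij} w_{rs}] = v_{(j,s)}; moreover the entries of v sum to 1. -/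
open MeasureTheory ProbabilityTheory Finset

section Combinatorics

variable {ι : Type*} [DecidableEq ι]

lemma exists_perm_apply_eq_apply_eq {i j i' j' : ι} (h : i ≠ j) (h' : i' ≠ j') :
    ∃ σ : Equiv.Perm ι, σ i = i' ∧ σ j = j' := by
  refine ⟨Equiv.swap (Equiv.swap i i' j) j' * Equiv.swap i i', ?_, ?_⟩
  · have h1 : i' ≠ Equiv.swap i i' j := fun e => h <| by
      rw [← Equiv.swap_apply_left i i'] at e
      exact (Equiv.swap i i').injective (by simpa using e)
    simp [Equiv.swap_apply_of_ne_of_ne h1 h']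
  · simp

lemma eq_of_perm_invariant {f : ι → ι → ℝ} (hf : ∀ (σ : Equiv.Perm ι) i j, f (σ i) (σ j) = f i j)
    {i j i' j' : ι} (h : i ≠ j) (h' : i' ≠ j') : f i j = f i' j' := by
  obtain ⟨σ, rfl, rfl⟩ := exists_perm_apply_eq_apply_eq h h'
  exact (hf σ i j).symm

lemma diag_eq_of_perm_invariant {f : ι → ι → ℝ}
    (hf : ∀ (σ : Equiv.Perm ι) i j, f (σ i) (σ j) = f i j) (i i' : ι) : f i i = f i' i' := by
  simpa using (hf (Equiv.swap i i') i i).symm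

variable [Fintype ι]

/-- The probability that the out-neighbourhood of `i` in the random digraph is `S`. -/
def outWeight (p : ℝ) (i : ι) (S : Finset ι) : ℝ :=
  if i ∈ S then 0 else p ^ #S * (1 - p) ^ (Fintype.card ι - 1 - #S)

/-- The `(i, j)` entry of the row-stochastic matrix when the out-neighbourhood of `i` is `S`. -/
noncomputable def walkWeight (i j : ι) (S : Finset ι) : ℝ :=
  if j = i ∨ j ∈ S then 1 / (#S + 1 : ℝ) else 0

lemma outWeight_map (p : ℝ) (σ : Equiv.Perm ι) (i : ι) (S : Finset ι) :
    outWeight p (σ i) (S.map σ.toEmbedding) = outWeight p i S := by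
  simp [outWeight]

omit [Fintype ι] in
lemma walkWeight_map (σ : Equiv.Perm ι) (i j : ι) (S : Finset ι) :
    walkWeight (σ i) (σ j) (S.map σ.toEmbedding) = walkWeight i j S := by
  simp [walkWeight]

omit [Fintype ι] in
lemma walkWeight_mul_self (i j : ι) (S : Finset ι) :
    walkWeight i j S * walkWeight i j S = walkWeight i i S * walkWeight i j S := by
  by_cases h : j = i ∨ j ∈ S <;> simp [walkWeight, h]

lemma sum_walkWeight {i : ι} {S : Finset ι} (h : i ∉ S) : ∑ j, walkWeight i j S = 1 := by
  have h1 : (univ.filter fun j => j = i ∨ j ∈ S) = insert i S := by ext; simp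
  have h2 : ((#S : ℝ) + 1) ≠ 0 := by positivity
  simp only [walkWeight]
  rw [← Finset.sum_filter, h1, sum_const, card_insert_of_notMem h]
  simp [h2]

/-- The expectation of the `(i, j)` entry of the matrix. -/
noncomputable def walkMean (p : ℝ) (i j : ι) : ℝ := ∑ S, outWeight p i S * walkWeight i j S

/-- The expectation of the product of the `(i, j)` and `(i, s)` entries of the matrix. -/
noncomputable def walkMixedMean (p : ℝ) (i j s : ι) : ℝ :=
  ∑ S, outWeight p i S * (walkWeight i j S * walkWeight i s S)

lemma walkMean_perm (p : ℝ) (σ : Equiv.Perm ι) (i j : ι) :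
    walkMean p (σ i) (σ j) = walkMean p i j := by
  rw [walkMean, ← (Equiv.finsetCongr σ).sum_comp]
  simp [walkMean, outWeight_map, walkWeight_map]

lemma walkMixedMean_perm (p : ℝ) (σ : Equiv.Perm ι) (i j s : ι) :
    walkMixedMean p (σ i) (σ j) (σ s) = walkMixedMean p i j s := by
  rw [walkMixedMean, ← (Equiv.finsetCongr σ).sum_comp]
  simp [walkMixedMean, outWeight_map, walkWeight_map]

lemma outWeight_mul_sum_walkWeight (p : ℝ) (i : ι) (S : Finset ι) :
    outWeight p i S * ∑ j, walkWeight i j S = outWeight p i S := by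
  by_cases h : i ∈ S
  · simp [outWeight, h]
  · rw [sum_walkWeight h, mul_one]

lemma sum_walkMixedMean (p : ℝ) (i j : ι) : ∑ s, walkMixedMean p i j s = walkMean p i j := by
  simp only [walkMixedMean, walkMean]
  rw [sum_comm]
  refine sum_congr rfl fun S _ => ?_
  rw [← mul_sum, ← mul_sum, mul_left_comm, outWeight_mul_sum_walkWeight, mul_comm]

lemma sum_powerset_outWeight (p : ℝ) (i : ι) (g : ℕ → ℝ) :
    ∑ S, outWeight p i S * g #S = ∑ k ∈ range (Fintype.card ι - 1 + 1),
      ((Fintype.card ι - 1).choose k : ℝ) *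
        (p ^ k * (1 - p) ^ (Fintype.card ι - 1 - k) * g k) := by
  have h1 : ∑ S, outWeight p i S * g #S = ∑ S ∈ (univ.erase i).powerset,
      p ^ #S * (1 - p) ^ (Fintype.card ι - 1 - #S) * g #S := by
    have h2 : (univ.filter fun S : Finset ι => i ∉ S) = (univ.erase i).powerset := by
      ext S; simp [Finset.subset_erase]
    rw [← h2, sum_filter]
    refine sum_congr rfl fun S _ => ?_
    by_cases h : i ∈ S <;> simp [outWeight, h]
  rw [h1, sum_powerset_apply_card
    (fun k => p ^ k * (1 - p) ^ (Fintype.card ι - 1 - k) * g k)]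
  simp [card_erase_of_mem]

lemma sum_outWeight (p : ℝ) (i : ι) : ∑ S, outWeight p i S = 1 := by
  have h := sum_powerset_outWeight p i fun _ => 1
  simp only [mul_one] at h
  have h2 := add_pow p (1 - p) (Fintype.card ι - 1)
  rw [add_sub_cancel, one_pow] at h2
  refine h.trans (Eq.trans (sum_congr rfl fun k _ => ?_) h2.symm)
  ring

lemma sum_walkMean (p : ℝ) (i : ι) : ∑ j, walkMean p i j = 1 := by
  simp only [walkMean]
  rw [sum_comm]
  simp only [← mul_sum, outWeight_mul_sum_walkWeight, sum_outWeight]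

lemma card_mul_mul_walkMean_self (p : ℝ) (i : ι) :
    Fintype.card ι * p * walkMean p i i = 1 - (1 - p) ^ Fintype.card ι := by
  have h : walkMean p i i = ∑ S, outWeight p i S * (fun k : ℕ => 1 / (k + 1 : ℝ)) #S := by
    simp [walkMean, walkWeight]
  rw [h, sum_powerset_outWeight p i fun k : ℕ => 1 / (k + 1 : ℝ)]
  obtain ⟨m, hm⟩ : ∃ m, Fintype.card ι = m + 1 :=
    ⟨Fintype.card ι - 1, (Nat.sub_add_cancel (Fintype.card_pos_iff.2 ⟨i⟩)).symm⟩
  rw [hm]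
  have h2 := add_pow p (1 - p) (m + 1)
  rw [add_sub_cancel, one_pow, sum_range_succ'] at h2
  simp only [Nat.add_sub_cancel, mul_sum]
  refine eq_sub_of_add_eq (Eq.trans (congrArg₂ (· + ·) ?_ ?_) h2.symm)
  · refine sum_congr rfl fun k _ => ?_
    have h3 : ((m + 1 : ℕ) : ℝ) * (m.choose k) = ((m + 1).choose (k + 1)) * (k + 1 : ℕ) := by
      exact_mod_cast Nat.add_one_mul_choose_eq m k
    have h4 : (k + 1 : ℝ) ≠ 0 := by positivity
    rw [Nat.add_sub_add_right]
    push_cast at h3 ⊢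
    field_simp
    rw [pow_succ]
    linear_combination p ^ k * p * (1 - p) ^ (m - k) * h3
  · simp

lemma sum_walkMean_left [Nonempty ι] (p : ℝ) (j : ι) : ∑ i, walkMean p i j = 1 := by
  have h : ∀ j' : ι, ∑ i, walkMean p i j' = ∑ i, walkMean p i j := fun j' => by
    rw [← Equiv.sum_comp (Equiv.swap j j')]
    refine sum_congr rfl fun i _ => ?_
    simpa using walkMean_perm p (Equiv.swap j j') i j
  have h1 : ∑ j' : ι, ∑ i, walkMean p i j' = Fintype.card ι := by
    rw [sum_comm]; simp [sum_walkMean]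
  have h2 : ∑ k : ι, ∑ i, walkMean p i k = ∑ _k : ι, ∑ i, walkMean p i j :=
    sum_congr rfl fun k _ => h k
  rw [h2] at h1
  simpa using h1

lemma sum_walkMixedMean_perm (p : ℝ) (σ : Equiv.Perm ι) (j s : ι) :
    ∑ i, walkMixedMean p i (σ j) (σ s) = ∑ i, walkMixedMean p i j s := by
  rw [← Equiv.sum_comp σ]
  simp [walkMixedMean_perm]

lemma walkMixedMean_self_right (p : ℝ) (i j : ι) :
    walkMixedMean p i j j = walkMixedMean p i i j := by
  simp only [walkMixedMean, walkWeight_mul_self]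

lemma sum_walkMixedMean_self (p : ℝ) (i j : ι) :
    ∑ r, walkMixedMean p r j j = walkMean p i i := by
  have : Nonempty ι := ⟨i⟩
  have h (j' : ι) : ∑ r, walkMixedMean p r j' j' = ∑ r, walkMixedMean p r j j :=
    diag_eq_of_perm_invariant (f := fun j s => ∑ r, walkMixedMean p r j s)
      (sum_walkMixedMean_perm p) j' j
  have h1 : ∑ j' : ι, ∑ r, walkMixedMean p r j' j' = Fintype.card ι * walkMean p i i := by
    rw [sum_comm]
    simp only [walkMixedMean_self_right, sum_walkMixedMean]
    simp [diag_eq_of_perm_invariant (walkMean_perm p) _ i]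
  have h2 : ∑ k : ι, ∑ r, walkMixedMean p r k k = ∑ _k : ι, ∑ r, walkMixedMean p r j j :=
    sum_congr rfl fun k _ => h k
  rw [h2] at h1
  simpa using h1

lemma sum_ite_eq_add_card_sub_one_mul (i : ι) (x y : ℝ) :
    ∑ j, (if i = j then x else y) = x + (Fintype.card ι - 1) * y := by
  have h (j) : (if i = j then x else y) = y + if i = j then x - y else 0 := by
    split_ifs <;> ring
  simp only [h, sum_add_distrib]
  simp
  ring

lemma sum_ite_mul_ite (j s : ι) (x y : ℝ) :
    ∑ i, (if i = j then x else y) * (if i = s then x else y) =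
      Fintype.card ι * y ^ 2 + 2 * y * (x - y) + if j = s then (x - y) ^ 2 else 0 := by
  have h (i j : ι) : (if i = j then x else y) = y + if i = j then x - y else 0 := by
    split_ifs <;> ring
  simp only [h, mul_add, add_mul, sum_add_distrib]
  simp only [sum_const, card_univ, nsmul_eq_mul, sum_ite_eq', mem_univ, if_true,
    mul_ite, mul_zero, ite_mul, zero_mul]
  split_ifs <;> grind

/-- The vector with entries `1` on the diagonal and `ρ` off it is a left eigenvector, with
eigenvalue `1`, of the expected Kronecker square. -/
lemma sum_mul_expected_kronecker {p ρ : ℝ} (hn : 2 ≤ Fintype.card ι)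
    (hρ : ρ * (p * (Fintype.card ι - 2) + 1 - (1 - p) ^ Fintype.card ι) =
      p * (Fintype.card ι - 1)) (hp : p ≠ 0) (j s : ι) :
    ∑ ir : ι × ι, (if ir.1 = ir.2 then 1 else ρ) *
      (if ir.1 = ir.2 then walkMixedMean p ir.1 j s else walkMean p ir.1 j * walkMean p ir.2 s) =
      if j = s then 1 else ρ := by
  have : Nonempty ι := ⟨j⟩
  obtain ⟨j', hj'⟩ : ∃ j', j ≠ j' := by
    have : Nontrivial ι := Fintype.one_lt_card_iff_nontrivial.1 (by omega)
    exact (exists_ne j).imp fun _ h => h.symm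
  set N : ℝ := (Fintype.card ι : ℝ) with hN
  have hN1 : N - 1 ≠ 0 := by
    have : (2 : ℝ) ≤ N := by rw [hN]; exact_mod_cast hn
    linarith
  set α := walkMean p j j
  set β := walkMean p j j'
  have hm (i j : ι) : walkMean p i j = if i = j then α else β := by
    split_ifs with h
    · subst h; exact diag_eq_of_perm_invariant (walkMean_perm p) _ _
    · exact eq_of_perm_invariant (walkMean_perm p) h hj'
  have hαβ : α + (N - 1) * β = 1 := by
    rw [hN, ← sum_ite_eq_add_card_sub_one_mul j]
    exact (sum_congr rfl fun k _ => (hm j k).symm).trans (sum_walkMean p j)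
  have hD (j s : ι) : ∑ i, walkMixedMean p i j s = if j = s then α else β := by
    split_ifs with h
    · subst h; exact sum_walkMixedMean_self p _ _
    · have h1 : ∑ k : ι, ∑ i, walkMixedMean p i j k = 1 := by
        rw [sum_comm]; simp [sum_walkMixedMean, sum_walkMean_left]
      have h2 (k : ι) : ∑ i, walkMixedMean p i j k =
          if j = k then α else ∑ i, walkMixedMean p i j s := by
        split_ifs with hk
        · subst hk; exact sum_walkMixedMean_self p _ _
        · exact eq_of_perm_invariant (f := fun j s => ∑ i, walkMixedMean p i j s)
            (sum_walkMixedMean_perm p) hk h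
      have h3 : ∑ k : ι, ∑ i, walkMixedMean p i j k =
          ∑ k, if j = k then α else ∑ i, walkMixedMean p i j s := sum_congr rfl fun k _ => h2 k
      rw [h3, sum_ite_eq_add_card_sub_one_mul] at h1
      exact mul_left_cancel₀ hN1 (by linear_combination h1 - hαβ)
  have hpα : N * p * α = 1 - (1 - p) ^ Fintype.card ι := card_mul_mul_walkMean_self p j
  have hρ' : ρ * (2 * α + (N - 2) * β) = 1 := by
    have h1 : ρ * (N - 2 + N * α) = N - 1 :=
      mul_left_cancel₀ hp (by linear_combination hρ + ρ * hpα)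
    exact mul_left_cancel₀ hN1 (by linear_combination h1 + ρ * (N - 2) * hαβ)
  have hterm (i r : ι) : (if i = r then 1 else ρ) *
      (if i = r then walkMixedMean p i j s else walkMean p i j * walkMean p r s) =
      (if i = r then walkMixedMean p i j s - ρ * (walkMean p i j * walkMean p i s) else 0) +
        ρ * (walkMean p i j * walkMean p r s) := by
    split_ifs with h
    · subst h; ring
    · ring
  have hS : ∑ i, walkMean p i j * walkMean p i s =
      N * β ^ 2 + 2 * β * (α - β) + if j = s then (α - β) ^ 2 else 0 := by
    simp only [hm]
    exact sum_ite_mul_ite j s α β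
  rw [Fintype.sum_prod_type]
  simp only [hterm, sum_add_distrib, ← mul_sum, sum_walkMean_left, sum_ite_eq, mem_univ, if_true,
    sum_sub_distrib, mul_one, hS, hD]
  split_ifs with h
  · linear_combination (1 - ρ * (N - 1) * β - ρ * (1 + α)) * hαβ + (N - 1) * β * hρ'
  · linear_combination (-β) * hρ'

end Combinatorics


section RandomDigraph

variable {ι Ω : Type*} [DecidableEq ι] [Fintype ι] {mΩ : MeasurableSpace Ω} {μ : Measure Ω}
  {a : ι → ι → Ω → ℝ} {p : ℝ}

/-- The set of vertices joined to `i` by an edge leaving `i`. -/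
noncomputable def outNeighbors (a : ι → ι → Ω → ℝ) (i : ι) (ω : Ω) : Finset ι :=
  univ.filter fun j => a i j ω = 1

omit [DecidableEq ι] in
lemma measurableSet_outNeighbors_eq (hmeas : ∀ i j, Measurable (a i j)) (i : ι) (S : Finset ι) :
    MeasurableSet {ω | outNeighbors a i ω = S} := by
  classical
  have h : {ω | outNeighbors a i ω = S} =
      ⋂ j, a i j ⁻¹' (if j ∈ S then {1} else {1}ᶜ) := by
    ext ω
    simp only [outNeighbors, Finset.ext_iff, mem_filter, mem_univ, true_and, Set.mem_ofPred_eq,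
      Set.mem_iInter]
    refine forall_congr' fun j => ?_
    split_ifs with hj <;> simp [hj]
  rw [h]
  refine MeasurableSet.iInter fun j => hmeas i j ?_
  split_ifs
  · exact measurableSet_singleton 1
  · exact (measurableSet_singleton 1).compl

lemma measureReal_outNeighbors_eq [IsProbabilityMeasure μ] (hp : 0 ≤ p)
    (hdiag : ∀ i ω, a i i ω = 0) (hmeas : ∀ i j, Measurable (a i j))
    (hber : ∀ i j, i ≠ j → μ {ω | a i j ω = 1} = ENNReal.ofReal p)
    (hind : iIndepFun (fun ij : {ij : ι × ι // ij.1 ≠ ij.2} => a ij.1.1 ij.1.2) μ)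
    (i : ι) (S : Finset ι) :
    μ.real {ω | outNeighbors a i ω = S} = outWeight p i S := by
  unfold outWeight
  split_ifs with hi
  · have h : {ω | outNeighbors a i ω = S} = ∅ := by
      refine Set.eq_empty_of_forall_notMem fun ω (hω : outNeighbors a i ω = S) => ?_
      have h1 : i ∈ outNeighbors a i ω := by rw [hω]; exact hi
      simp [outNeighbors, hdiag] at h1
    simp [h]
  let B (j : {j // j ≠ i}) : Set ℝ := if j.1 ∈ S then {1} else {1}ᶜ
  have hB (j : {j // j ≠ i}) : MeasurableSet (B j) := by
    simp only [B]
    split_ifs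
    · exact measurableSet_singleton 1
    · exact (measurableSet_singleton 1).compl
  have h : {ω | outNeighbors a i ω = S} = ⋂ j : {j // j ≠ i}, a i j ⁻¹' B j := by
    ext ω
    simp only [outNeighbors, Finset.ext_iff, mem_filter, mem_univ, true_and, Set.mem_ofPred_eq,
      Set.mem_iInter]
    have h1 (j : {j // j ≠ i}) : ω ∈ a i j ⁻¹' B j ↔ (a i j ω = 1 ↔ j.1 ∈ S) := by
      simp only [B]
      split_ifs with hj <;> simp [hj]
    simp only [h1]
    refine ⟨fun h j => h j, fun h j => ?_⟩
    by_cases hj : j = i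
    · subst hj; simp [hdiag, hi]
    · exact h ⟨j, hj⟩
  have hinj : Function.Injective
      (fun j : {j // j ≠ i} => (⟨(i, j.1), j.2.symm⟩ : {ij : ι × ι // ij.1 ≠ ij.2})) := by
    intro j k hjk
    simpa [Subtype.ext_iff] using hjk
  have hprob (j : {j // j ≠ i}) : μ.real (a i j ⁻¹' B j) = if j.1 ∈ S then p else 1 - p := by
    have h1 : μ.real (a i j ⁻¹' {1}) = p := by
      rw [measureReal_def]
      exact (congrArg ENNReal.toReal (hber i j j.2.symm)).trans (ENNReal.toReal_ofReal hp)
    simp only [B]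
    split_ifs
    · exact h1
    · rw [Set.preimage_compl, probReal_compl_eq_one_sub (hmeas i j (measurableSet_singleton 1)), h1]
  rw [h, measureReal_def,
    (hind.precomp hinj).meas_iInter (s := fun j : {j // j ≠ i} => a i j ⁻¹' B j)
      fun j => ⟨B j, hB j, rfl⟩,
    ENNReal.toReal_prod]
  simp only [← measureReal_def, hprob]
  rw [← Finset.prod_subtype (univ.erase i) (by simp) fun j => if j ∈ S then p else 1 - p,
    prod_ite, prod_const, prod_const]
  have hS : (univ.erase i).filter (· ∈ S) = S := by
    ext j
    simp only [mem_filter, mem_erase, mem_univ, and_true, and_iff_right_iff_imp]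
    rintro hj rfl
    exact hi hj
  have hS' := card_filter_add_card_filter_not (s := univ.erase i) (· ∈ S)
  rw [hS, card_erase_of_mem (mem_univ i), card_univ] at hS'
  rw [hS, ← hS', Nat.add_sub_cancel_left]

lemma integral_outNeighbors [IsProbabilityMeasure μ] (hp : 0 ≤ p)
    (hdiag : ∀ i ω, a i i ω = 0) (hmeas : ∀ i j, Measurable (a i j))
    (hber : ∀ i j, i ≠ j → μ {ω | a i j ω = 1} = ENNReal.ofReal p)
    (hind : iIndepFun (fun ij : {ij : ι × ι // ij.1 ≠ ij.2} => a ij.1.1 ij.1.2) μ)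
    (i : ι) (F : Finset ι → ℝ) :
    ∫ ω, F (outNeighbors a i ω) ∂μ = ∑ S, outWeight p i S * F S := by
  have h (ω : Ω) : F (outNeighbors a i ω) =
      ∑ S, {ω | outNeighbors a i ω = S}.indicator (fun _ => F S) ω := by
    simp [Set.indicator_apply]
  have hS := measurableSet_outNeighbors_eq hmeas i
  simp only [h]
  rw [integral_finsetSum _ fun S _ => (integrable_const _).indicator (hS S)]
  refine sum_congr rfl fun S _ => ?_
  rw [integral_indicator_const _ (hS S),
    measureReal_outNeighbors_eq hp hdiag hmeas hber hind, smul_eq_mul]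

omit [Fintype ι] in
lemma indepFun_rows [Finite ι] (hdiag : ∀ i ω, a i i ω = 0) (hmeas : ∀ i j, Measurable (a i j))
    (hind : iIndepFun (fun ij : {ij : ι × ι // ij.1 ≠ ij.2} => a ij.1.1 ij.1.2) μ)
    {i r : ι} (hir : i ≠ r) : IndepFun (fun ω k => a i k ω) (fun ω k => a r k ω) μ := by
  have := Fintype.ofFinite ι
  let T (i : ι) : Finset {ij : ι × ι // ij.1 ≠ ij.2} := univ.filter fun x => x.1.1 = i
  let ext (i : ι) (y : T i → ℝ) (k : ι) : ℝ :=
    if h : i ≠ k then y ⟨⟨(i, k), h⟩, by simp [T]⟩ else 0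
  have hext (i : ι) : Measurable (ext i) := by
    refine measurable_pi_lambda _ fun k => ?_
    simp only [ext]
    split_ifs <;> fun_prop
  have hrow (i : ι) : (fun ω k => a i k ω) =
      ext i ∘ fun ω (x : T i) => a x.1.1.1 x.1.1.2 ω := by
    funext ω k
    by_cases h : i = k
    · subst h; simp [ext, hdiag]
    · simp [ext, h]
  have hT : Disjoint (T i) (T r) := by
    simp only [T, disjoint_filter]
    rintro x - rfl h
    exact hir h
  rw [hrow i, hrow r]
  exact (hind.indepFun_finset (T i) (T r) hT fun x => hmeas _ _).comp (hext i) (hext r)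

lemma entry_eq_walkWeight (ha01 : ∀ i j ω, a i j ω = 0 ∨ a i j ω = 1) (i j : ι) (ω : Ω) :
    (if i = j then 1 else a i j ω) / (∑ k, a i k ω + 1) =
      walkWeight i j (outNeighbors a i ω) := by
  have h (k : ι) : a i k ω = if a i k ω = 1 then 1 else 0 := by
    rcases ha01 i k ω with h | h <;> simp [h]
  have hsum : ∑ k, a i k ω = #(outNeighbors a i ω) := by
    rw [outNeighbors, ← sum_boole]
    exact sum_congr rfl fun k _ => h k
  rw [hsum]
  by_cases hij : i = j
  · simp [walkWeight, hij]
  · rcases ha01 i j ω with h0 | h0 <;>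
      simp [walkWeight, hij, Ne.symm hij, h0, mem_filter, outNeighbors]

/-- The entries of the expectation of `W ⊗ W`. -/
lemma integral_entry_mul_entry [IsProbabilityMeasure μ] (hp : 0 ≤ p)
    (ha01 : ∀ i j ω, a i j ω = 0 ∨ a i j ω = 1)
    (hdiag : ∀ i ω, a i i ω = 0) (hmeas : ∀ i j, Measurable (a i j))
    (hber : ∀ i j, i ≠ j → μ {ω | a i j ω = 1} = ENNReal.ofReal p)
    (hind : iIndepFun (fun ij : {ij : ι × ι // ij.1 ≠ ij.2} => a ij.1.1 ij.1.2) μ)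
    (i r j s : ι) :
    ∫ ω, (if i = j then 1 else a i j ω) / (∑ k, a i k ω + 1) *
        ((if r = s then 1 else a r s ω) / (∑ k, a r k ω + 1)) ∂μ =
      if i = r then walkMixedMean p i j s else walkMean p i j * walkMean p r s := by
  by_cases h : i = r
  · subst h
    rw [if_pos rfl]
    simp only [entry_eq_walkWeight ha01]
    exact integral_outNeighbors hp hdiag hmeas hber hind i
      fun S => walkWeight i j S * walkWeight i s S
  · rw [if_neg h]
    let φ (i j : ι) (y : ι → ℝ) : ℝ := (if i = j then 1 else y j) / (∑ k, y k + 1)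
    have hφ (i j : ι) : Measurable (φ i j) := by
      simp only [φ]
      split_ifs <;> fun_prop
    have hrow (i : ι) : Measurable fun ω k => a i k ω := measurable_pi_lambda _ (hmeas i)
    have hind' := (indepFun_rows hdiag hmeas hind h).comp (hφ i j) (hφ r s)
    refine (hind'.integral_fun_mul_eq_mul_integral
      ((hφ i j).comp (hrow i)).aestronglyMeasurable
      ((hφ r s).comp (hrow r)).aestronglyMeasurable).trans ?_
    simp only [Function.comp_def, φ, entry_eq_walkWeight ha01]
    rw [integral_outNeighbors hp hdiag hmeas hber hind i (walkWeight i j),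
      integral_outNeighbors hp hdiag hmeas hber hind r (walkWeight r s)]
    rfl

end RandomDigraph


/-- The vector `v ∈ ℝ^{n²}` indexed by pairs `(i,r)`, with
`v_{(i,r)} = ρ/δ` for `i ≠ r` and `v_{(i,i)} = 1/δ` (i.e.
`v = (1/δ)[ρ (1ₙ ⊗ 1ₙ) + (1-ρ) ∑ᵢ eᵢ ⊗ eᵢ]`), is a left eigenvector of `E[W ⊗ W]`
associated with the unit eigenvalue, and its entries sum to `1`. -/
theorem left_eigenvector_of_expected_kronecker
    {Ω : Type*} [MeasurableSpace Ω] (μ : Measure Ω) [IsProbabilityMeasure μ]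
    (n : ℕ) (hn : 3 ≤ n) (p q : ℝ) (hp : p ∈ Set.Ioo (0 : ℝ) 1) (hq : q = 1 - p)
    (a : Fin n → Fin n → Ω → ℝ)
    (ha01 : ∀ i j ω, a i j ω = 0 ∨ a i j ω = 1)
    (hdiag : ∀ i ω, a i i ω = 0)
    (hmeas : ∀ i j, Measurable (a i j))
    (hber : ∀ i j, i ≠ j → μ {ω | a i j ω = 1} = ENNReal.ofReal p)
    (hind : iIndepFun (m := fun _ => Real.measurableSpace)
      (fun ij : {ij : Fin n × Fin n // ij.1 ≠ ij.2} => a ij.1.1 ij.1.2) μ)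
    (d : Fin n → Ω → ℝ) (hd : ∀ i ω, d i ω = ∑ j, a i j ω)
    (W : Ω → Fin n → Fin n → ℝ)
    (hW : ∀ ω i j, W ω i j = if i = j then 1 / (d i ω + 1) else a i j ω / (d i ω + 1))
    (M : (Fin n × Fin n) → (Fin n × Fin n) → ℝ)
    (hM : ∀ ir js, M ir js = ∫ ω, W ω ir.1 js.1 * W ω ir.2 js.2 ∂μ)
    (ρ δ : ℝ)
    (hρ : ρ = p * (n - 1) / (p * (n - 2) + 1 - q ^ n))
    (hδ : δ = n + n * (n - 1) * ρ)
    (v : Fin n × Fin n → ℝ)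
    (hv : ∀ ir : Fin n × Fin n, v ir = if ir.1 = ir.2 then 1 / δ else ρ / δ) :
    (∀ js : Fin n × Fin n, (∑ ir : Fin n × Fin n, v ir * M ir js) = v js) ∧
    (∑ ir : Fin n × Fin n, v ir) = 1 := by
  subst hq
  obtain ⟨hp0, hp1⟩ := hp
  have hn3 : (3 : ℝ) ≤ n := by exact_mod_cast hn
  have hden : 0 < p * (n - 2) + 1 - (1 - p) ^ n := by
    have h1 : (1 - p) ^ n ≤ 1 := pow_le_one₀ (by linarith) (by linarith)
    have h2 : 0 < p * ((n : ℝ) - 2) := mul_pos hp0 (by linarith)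
    linarith
  have hρ0 : 0 ≤ ρ := by
    rw [hρ]
    exact div_nonneg (mul_nonneg hp0.le (by linarith)) hden.le
  have hδ0 : δ ≠ 0 := by
    have h1 : 0 ≤ (n : ℝ) * (n - 1) * ρ :=
      mul_nonneg (mul_nonneg (by linarith) (by linarith)) hρ0
    rw [hδ]
    linarith
  have hρ' : ρ * (p * (n - 2) + 1 - (1 - p) ^ n) = p * (n - 1) := by
    rw [hρ, div_mul_cancel₀ _ hden.ne']
  have hv' (ir : Fin n × Fin n) : v ir = 1 / δ * if ir.1 = ir.2 then 1 else ρ := by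
    rw [hv]
    split_ifs <;> ring
  have hM' (ir js : Fin n × Fin n) : M ir js = if ir.1 = ir.2 then walkMixedMean p ir.1 js.1 js.2
      else walkMean p ir.1 js.1 * walkMean p ir.2 js.2 := by
    rw [hM, ← integral_entry_mul_entry hp0.le ha01 hdiag hmeas hber hind]
    have h (ω : Ω) (i j : Fin n) :
        W ω i j = (if i = j then 1 else a i j ω) / (∑ k, a i k ω + 1) := by
      rw [hW, hd]
      split_ifs <;> rfl
    simp only [h]
  refine ⟨fun js => ?_, ?_⟩
  · have h := sum_mul_expected_kronecker (ι := Fin n) (p := p) (ρ := ρ)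
      (by simp only [Fintype.card_fin]; omega) (by simpa using hρ') hp0.ne' js.1 js.2
    rw [hv', ← h, mul_sum]
    refine sum_congr rfl fun ir _ => ?_
    rw [hv', hM', mul_assoc]
  · rw [Fintype.sum_prod_type]
    simp only [hv', ← mul_sum, sum_ite_eq_add_card_sub_one_mul, sum_const, card_univ,
      Fintype.card_fin, nsmul_eq_mul]
    rw [one_div, inv_mul_eq_one₀ hδ0, hδ]
    ring
end
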